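/- arXiv:0709.0313 — 2 statements merged into one kernel-verified Lean document; each statement's English description precedes it below -/
import Mathlib

section
/- For almost every x ∈ (0,1), the limit lim_{n→∞} (log q_n)/n exists and equals π²/(12·log 2), where q_n is the denominator of the n-th continued fraction convergent of x (Lévy's theorem, obtained here as the classical case of Theorem 3). -/
open Filter MeasureTheory Real Topology

/-- The Gauss map `x ↦ {1/x}`. -/
noncomputable def gaussMap (x : ℝ) : ℝ := Int.fract x⁻¹

/-- `partQuot x n` is the `n`-th partial quotient `aₙ` of the regular continued fraction
expansion `x = [a₁, a₂, …]` of `x ∈ (0,1)` (meaningful for `n ≥ 1`). -/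
noncomputable def partQuot (x : ℝ) (n : ℕ) : ℕ := (⌊(gaussMap^[n - 1] x)⁻¹⌋).toNat

/-- `cfQ x n` is the denominator `qₙ` of the `n`-th continued fraction convergent
`pₙ/qₙ = [a₁, …, aₙ]` of `x`, given by `q₀ = 1`, `q₁ = a₁`, `qₙ = aₙ qₙ₋₁ + qₙ₋₂`. -/
noncomputable def cfQ (x : ℝ) : ℕ → ℤ
  | 0 => 1
  | 1 => partQuot x 1
  | (n + 2) => partQuot x (n + 2) * cfQ x (n + 1) + cfQ x n

/-- `cfP x n` is the numerator `pₙ` of the `n`-th continued fraction convergent of `x`,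
given by `p₀ = 0`, `p₁ = 1`, `pₙ = aₙ pₙ₋₁ + pₙ₋₂`. -/
noncomputable def cfP (x : ℝ) : ℕ → ℤ
  | 0 => 0
  | 1 => 1
  | (n + 2) => partQuot x (n + 2) * cfP x (n + 1) + cfP x n


/-! ### Denominators and the orbit of the Gauss map -/

lemma gaussMap_mem {x : ℝ} (hx : Irrational x) :
    Irrational (gaussMap x) ∧ gaussMap x ∈ Set.Ioo (0 : ℝ) 1 := by
  have h1 : Irrational (gaussMap x) := by
    unfold gaussMap
    rw [Int.fract]
    exact (hx.inv).sub_intCast _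
  refine ⟨h1, ?_, Int.fract_lt_one _⟩
  exact lt_of_le_of_ne (Int.fract_nonneg _) (fun h => h1.ne_zero h.symm)

lemma gaussMap_iter_mem {x : ℝ} (hx : Irrational x) (hx' : x ∈ Set.Ioo (0 : ℝ) 1) (n : ℕ) :
    Irrational (gaussMap^[n] x) ∧ gaussMap^[n] x ∈ Set.Ioo (0 : ℝ) 1 := by
  cases n with
  | zero => exact ⟨hx, hx'⟩
  | succ n =>
    have : Irrational (gaussMap^[n] x) := by
      induction n with
      | zero => exact hx
      | succ n ih => rw [Function.iterate_succ_apply']; exact (gaussMap_mem ih).1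
    rw [Function.iterate_succ_apply']
    exact gaussMap_mem this

lemma partQuot_spec {x : ℝ} (hx : Irrational x) (hx' : x ∈ Set.Ioo (0 : ℝ) 1) (n : ℕ) :
    (1 : ℝ) ≤ partQuot x (n + 1) ∧
    ((partQuot x (n + 1) : ℝ) + gaussMap^[n + 1] x) * gaussMap^[n] x = 1 := by
  obtain ⟨-, h0, h1⟩ := gaussMap_iter_mem hx hx' n
  have hf : 1 ≤ ⌊(gaussMap^[n] x)⁻¹⌋ := by
    rw [Int.le_floor]
    push_cast
    exact (one_le_inv₀ h0).2 h1.le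
  have hc : (partQuot x (n + 1) : ℝ) = (⌊(gaussMap^[n] x)⁻¹⌋ : ℝ) := by
    unfold partQuot
    simp only [Nat.add_sub_cancel]
    have : ((⌊(gaussMap^[n] x)⁻¹⌋).toNat : ℤ) = ⌊(gaussMap^[n] x)⁻¹⌋ :=
      Int.toNat_of_nonneg (by omega)
    exact_mod_cast this
  constructor
  · rw [hc]; exact_mod_cast hf
  · rw [hc, Function.iterate_succ_apply']
    have : (⌊(gaussMap^[n] x)⁻¹⌋ : ℝ) + gaussMap (gaussMap^[n] x) = (gaussMap^[n] x)⁻¹ := by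
      unfold gaussMap
      exact Int.floor_add_fract _
    rw [this, inv_mul_cancel₀ h0.ne']

lemma cfQ_bounds {x : ℝ} (hx : Irrational x) (hx' : x ∈ Set.Ioo (0 : ℝ) 1) (n : ℕ) :
    (1 : ℝ) ≤ cfQ x n ∧ (cfQ x n : ℝ) ≤ cfQ x (n + 1) ∧
    (cfQ x (n + 1) : ℝ) * ∏ k ∈ Finset.range (n + 1), gaussMap^[k] x
      + (cfQ x n : ℝ) * ∏ k ∈ Finset.range (n + 2), gaussMap^[k] x = 1 := by
  induction n with
  | zero =>
    obtain ⟨h1, h2⟩ := partQuot_spec hx hx' 0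
    simp only [Finset.prod_range_succ, Finset.prod_range_zero, cfQ]
    push_cast
    simp only [zero_add] at h1 h2
    refine ⟨le_rfl, h1, ?_⟩
    simp only [Function.iterate_zero, id, Function.iterate_succ, Function.comp] at h2 ⊢
    linarith
  | succ n ih =>
    obtain ⟨i1, i2, i3⟩ := ih
    obtain ⟨h1, h2⟩ := partQuot_spec hx hx' (n + 1)
    have e : (cfQ x (n + 2) : ℝ) = partQuot x (n + 2) * cfQ x (n + 1) + cfQ x n := by
      rw [cfQ]; push_cast; rfl
    refine ⟨i1.trans i2, ?_, ?_⟩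
    · rw [show n + 1 + 1 = n + 2 from rfl, e]
      nlinarith
    · rw [show n + 1 + 1 = n + 2 from rfl, e, Finset.prod_range_succ _ (n + 2)]
      rw [Finset.prod_range_succ _ (n + 1)] at i3 ⊢
      have h2' : ((partQuot x (n + 2) : ℝ) + gaussMap^[n + 2] x) * gaussMap^[n + 1] x = 1 := h2
      linear_combination i3 + (cfQ x (n + 1) : ℝ)
        * (∏ k ∈ Finset.range (n + 1), gaussMap^[k] x) * h2'

lemma log_cfQ_near {x : ℝ} (hx : Irrational x) (hx' : x ∈ Set.Ioo (0 : ℝ) 1) (n : ℕ) :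
    |Real.log (cfQ x n) - ∑ k ∈ Finset.range n, (-Real.log (gaussMap^[k] x))| ≤ Real.log 2 := by
  cases n with
  | zero => simp [cfQ, Real.log_nonneg]
  | succ n =>
    obtain ⟨i1, i2, i3⟩ := cfQ_bounds hx hx' n
    have hpos : ∀ k, 0 < gaussMap^[k] x := fun k => (gaussMap_iter_mem hx hx' k).2.1
    have hlt : ∀ k, gaussMap^[k] x < 1 := fun k => (gaussMap_iter_mem hx hx' k).2.2
    set D := ∏ k ∈ Finset.range (n + 1), gaussMap^[k] x with hD
    have hDpos : 0 < D := Finset.prod_pos (fun k _ => hpos k)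
    rw [Finset.prod_range_succ _ (n + 1), ← hD] at i3
    have hq : (0 : ℝ) < cfQ x (n + 1) := by linarith
    have hlog : Real.log (cfQ x (n + 1)) - ∑ k ∈ Finset.range (n + 1), (-Real.log (gaussMap^[k] x))
        = Real.log (cfQ x (n + 1) * D) := by
      rw [Real.log_mul hq.ne' hDpos.ne', hD, Real.log_prod (fun k _ => (hpos k).ne')]
      simp
    rw [hlog]
    have hlow : (1 : ℝ) / 2 ≤ cfQ x (n + 1) * D := by
      have : (cfQ x n : ℝ) * (D * gaussMap^[n + 1] x) ≤ cfQ x (n + 1) * D := by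
        apply mul_le_mul i2 _ (mul_pos hDpos (hpos _)).le hq.le
        exact mul_le_of_le_one_right hDpos.le (hlt _).le
      linarith
    have hup : cfQ x (n + 1) * D ≤ 1 := by
      have : 0 ≤ (cfQ x n : ℝ) * (D * gaussMap^[n + 1] x) :=
        mul_nonneg (by linarith) (mul_pos hDpos (hpos _)).le
      linarith
    rw [abs_le]
    constructor
    · rw [← Real.log_inv]
      apply Real.log_le_log (by norm_num)
      linarith
    · exact (Real.log_nonpos (by linarith) hup).trans (Real.log_nonneg (by norm_num))

/-! ### The transfer operator -/

/-- Weights of the transfer operator of the Gauss map. -/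
noncomputable def gw (k : ℕ) (x : ℝ) : ℝ := (1 + x) / ((x + k + 1) * (x + k + 2))

lemma gw_nonneg (k : ℕ) {x : ℝ} (hx : 0 ≤ x) : 0 ≤ gw k x := by
  unfold gw; positivity

lemma gw_hasSum {x : ℝ} (hx : 0 ≤ x) : HasSum (fun k => gw k x) 1 := by
  rw [hasSum_iff_tendsto_nat_of_nonneg (fun k => gw_nonneg k hx)]
  have : ∀ n : ℕ, ∑ k ∈ Finset.range n, gw k x = 1 - (1 + x) / (n + (1 + x)) := by
    intro n
    induction n with
    | zero => simp; rw [div_self (by positivity)]; simp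
    | succ n ih =>
      rw [Finset.sum_range_succ, ih, gw]
      push_cast
      field_simp
      ring
  simp_rw [this]
  have h : Tendsto (fun n : ℕ => (1 + x) / ((n : ℝ) + (1 + x))) atTop (𝓝 0) := by
    apply Tendsto.const_div_atTop
    exact tendsto_atTop_add_const_right _ _ tendsto_natCast_atTop_atTop
  simpa using h.const_sub 1

lemma gw_sub {k : ℕ} {x y : ℝ} (hx : 0 ≤ x) (hy : 0 ≤ y) :
    gw k x - gw k y = (y - x) * ((-((k : ℝ) ^ 2 + k - 1) + x + y + x * y) /
      (((x + k + 1) * (y + k + 1)) * ((x + k + 2) * (y + k + 2)))) := by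
  unfold gw
  field_simp
  ring

lemma gw_sub_bound {k : ℕ} {x y : ℝ} (hx : x ∈ Set.Icc (0 : ℝ) 1) (hy : y ∈ Set.Icc (0 : ℝ) 1) :
    |gw k x - gw k y| ≤ |x - y| * (4 / (k + 1) ^ 2) := by
  obtain ⟨hx0, hx1⟩ := hx
  obtain ⟨hy0, hy1⟩ := hy
  have hk : (0 : ℝ) ≤ k := Nat.cast_nonneg k
  rw [gw_sub hx0 hy0, abs_mul, abs_sub_comm y x]
  apply mul_le_mul_of_nonneg_left _ (abs_nonneg _)
  rw [abs_div, abs_of_pos (a := ((x + k + 1) * (y + k + 1)) * ((x + k + 2) * (y + k + 2)))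
    (by positivity)]
  have hxy : x * y ≤ 1 := by nlinarith
  have hxy0 : 0 ≤ x * y := by positivity
  have h1 : |(-((k : ℝ) ^ 2 + k - 1) + x + y + x * y)| ≤ 4 * ((k : ℝ) + 2) ^ 2 := by
    rw [abs_le]; constructor <;> nlinarith
  have h2 : ((k : ℝ) + 1) ^ 2 * (k + 2) ^ 2 ≤
      ((x + k + 1) * (y + k + 1)) * ((x + k + 2) * (y + k + 2)) := by
    rw [pow_two, pow_two]
    gcongr <;> linarith
  calc _ ≤ 4 * ((k : ℝ) + 2) ^ 2 / (((k : ℝ) + 1) ^ 2 * (k + 2) ^ 2) := by gcongr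
    _ = _ := by field_simp

lemma gw_sub_bound' {k : ℕ} {x y : ℝ} (hx : x ∈ Set.Icc (0 : ℝ) 1) (hy : y ∈ Set.Icc (0 : ℝ) 1)
    (hk1 : 1 ≤ k) :
    |gw k x - gw k y| * (k / (k + 1)) ≤ |x - y| * (gw k 1 / 2) := by
  obtain ⟨hx0, hx1⟩ := hx
  obtain ⟨hy0, hy1⟩ := hy
  have hk : (1 : ℝ) ≤ k := by exact_mod_cast hk1
  rw [gw_sub hx0 hy0, abs_mul, abs_sub_comm y x, mul_assoc]
  apply mul_le_mul_of_nonneg_left _ (abs_nonneg _)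
  rw [abs_div, abs_of_pos (a := ((x + k + 1) * (y + k + 1)) * ((x + k + 2) * (y + k + 2)))
    (by positivity)]
  have hxy : x * y ≤ 1 := by nlinarith
  have hxy0 : 0 ≤ x * y := by positivity
  have h1 : |(-((k : ℝ) ^ 2 + k - 1) + x + y + x * y)| ≤ (k : ℝ) * (k + 1) := by
    rw [abs_le]; constructor <;> nlinarith
  have h2 : ((k : ℝ) + 1) ^ 2 * (k + 2) ^ 2 ≤
      ((x + k + 1) * (y + k + 1)) * ((x + k + 2) * (y + k + 2)) := by
    rw [pow_two, pow_two]
    gcongr <;> linarith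
  calc _ ≤ (k * ((k : ℝ) + 1)) / (((k : ℝ) + 1) ^ 2 * (k + 2) ^ 2) * (k / (k + 1)) := by gcongr
    _ ≤ _ := by
      unfold gw
      rw [show (k * ((k : ℝ) + 1)) / (((k : ℝ) + 1) ^ 2 * (k + 2) ^ 2) * (k / (k + 1))
        = k ^ 2 / ((k + 1) ^ 2 * (k + 2) ^ 2) by field_simp]
      rw [show (1 + (1 : ℝ)) / ((1 + k + 1) * (1 + k + 2)) / 2 = 1 / ((k + 2) * (k + 3)) by
        field_simp; ring]
      rw [div_le_div_iff₀ (by positivity) (by positivity)]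
      have : (k : ℝ) ^ 2 * (k + 3) ≤ (k + 1) ^ 2 * (k + 2) := by nlinarith
      nlinarith [mul_le_mul_of_nonneg_right this (by linarith : (0 : ℝ) ≤ k + 2)]

/-- The transfer operator of the Gauss map with respect to the Gauss measure. -/
noncomputable def gP (F : ℝ → ℝ) (x : ℝ) : ℝ :=
  (∑' k : ℕ, ENNReal.ofReal (gw k x * F (x + k + 1)⁻¹)).toReal

lemma gP_measurable {F : ℝ → ℝ} (hF : Measurable F) : Measurable (gP F) := by
  unfold gP gw
  apply Measurable.ennreal_toReal
  apply Measurable.tsum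
  intro k
  apply Measurable.ennreal_ofReal
  apply Measurable.mul
  · fun_prop
  · exact hF.comp (by fun_prop)

lemma gP_nonneg (F : ℝ → ℝ) (x : ℝ) : 0 ≤ gP F x := ENNReal.toReal_nonneg

lemma inv_mem {x : ℝ} (hx : 0 ≤ x) (k : ℕ) : (x + k + 1)⁻¹ ∈ Set.Ioc (0 : ℝ) 1 :=
  ⟨by positivity, inv_le_one_of_one_le₀ (by have : (0:ℝ) ≤ k := Nat.cast_nonneg k
                                            linarith)⟩

lemma gP_eq {F : ℝ → ℝ} {x : ℝ} (hx : 0 ≤ x) (hF : ∀ t ∈ Set.Ioc (0 : ℝ) 1, 0 ≤ F t)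
    (hs : Summable (fun k : ℕ => gw k x * F (x + k + 1)⁻¹)) :
    HasSum (fun k : ℕ => gw k x * F (x + k + 1)⁻¹) (gP F x) ∧
    ENNReal.ofReal (gP F x) = ∑' k : ℕ, ENNReal.ofReal (gw k x * F (x + k + 1)⁻¹) := by
  have hn : ∀ k : ℕ, 0 ≤ gw k x * F (x + k + 1)⁻¹ := fun k =>
    mul_nonneg (gw_nonneg k hx) (hF _ (inv_mem hx k))
  have e := ENNReal.ofReal_tsum_of_nonneg hn hs
  have e2 : gP F x = ∑' k : ℕ, gw k x * F (x + k + 1)⁻¹ := by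
    unfold gP
    rw [← e, ENNReal.toReal_ofReal (tsum_nonneg hn)]
  constructor
  · rw [e2]; exact hs.hasSum
  · rw [e2, e]

/-- Lipschitz on the unit interval. -/
def LipI (F : ℝ → ℝ) (K : ℝ) : Prop :=
  ∀ x ∈ Set.Icc (0 : ℝ) 1, ∀ y ∈ Set.Icc (0 : ℝ) 1, |F x - F y| ≤ K * |x - y|

lemma LipI.summable {F : ℝ → ℝ} {K : ℝ} (hK : 0 ≤ K) (hF : LipI F K) {x : ℝ} (hx : 0 ≤ x) :
    Summable (fun k : ℕ => gw k x * F (x + k + 1)⁻¹) := by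
  apply Summable.of_norm_bounded (g := fun k => gw k x * (|F 0| + K))
  · exact (gw_hasSum hx).summable.mul_right _
  · intro k
    rw [norm_mul, Real.norm_of_nonneg (gw_nonneg k hx)]
    apply mul_le_mul_of_nonneg_left _ (gw_nonneg k hx)
    have hm := inv_mem hx k
    have h := hF _ ⟨hm.1.le, hm.2⟩ 0 ⟨le_rfl, zero_le_one⟩
    rw [sub_zero, abs_of_pos hm.1] at h
    have h3 : K * (x + k + 1)⁻¹ ≤ K := mul_le_of_le_one_right hK hm.2
    have := abs_sub_abs_le_abs_sub (F (x + k + 1)⁻¹) (F 0)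
    rw [Real.norm_eq_abs]
    linarith

lemma LipI.contract {F : ℝ → ℝ} {K : ℝ} (hK : 0 ≤ K) (hF : LipI F K)
    (hF0 : ∀ t ∈ Set.Ioc (0 : ℝ) 1, 0 ≤ F t) : LipI (gP F) (23 / 24 * K) := by
  intro x hx y hy
  have hx0 := hx.1
  have hy0 := hy.1
  have sx := (gP_eq hx0 hF0 (hF.summable hK hx0)).1
  have sy := (gP_eq hy0 hF0 (hF.summable hK hy0)).1
  have s0 := (((gw_hasSum hx0).sub (gw_hasSum hy0))).mul_right (F (y + (0 : ℕ) + 1)⁻¹)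
  have hs := (sx.sub sy).sub s0
  rw [sub_self, zero_mul, sub_zero] at hs
  have hb : HasSum (fun k : ℕ => K * |x - y| *
      ((gw k x / 4 + gw k 1 / 2) + if k = 0 then (5 / 24 : ℝ) else 0))
      (K * |x - y| * ((1 / 4 + 1 / 2) + 5 / 24)) := by
    apply HasSum.mul_left
    apply HasSum.add
    · exact ((gw_hasSum hx0).div_const 4).add ((gw_hasSum zero_le_one).div_const 2)
    · exact hasSum_ite_eq 0 _
  have key := hs.norm_le_of_bounded hb ?_
  · rw [Real.norm_eq_abs] at key
    refine key.trans (le_of_eq ?_)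
    ring
  intro k
  rw [Real.norm_eq_abs]
  have hmx := inv_mem hx0 k
  have hmy := inv_mem hy0 k
  have hmy0 := inv_mem hy0 0
  set u := (x + k + 1)⁻¹ with hu
  set v := (y + k + 1)⁻¹ with hv
  set v0 := (y + (0 : ℕ) + 1)⁻¹ with hv0
  have hk : (0 : ℝ) ≤ k := Nat.cast_nonneg k
  have h1 := hF u ⟨hmx.1.le, hmx.2⟩ v ⟨hmy.1.le, hmy.2⟩
  have h2 := hF v ⟨hmy.1.le, hmy.2⟩ v0 ⟨hmy0.1.le, hmy0.2⟩
  have huv : |u - v| = |x - y| * (u * v) := by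
    have : u - v = (y - x) * (u * v) := by
      rw [hu, hv]; field_simp; ring
    rw [this, abs_mul, abs_of_pos (mul_pos hmx.1 hmy.1), abs_sub_comm]
  have hvv : |v - v0| ≤ k / (k + 1) := by
    have : v0 - v = k / ((y + 1) * (y + k + 1)) := by
      rw [hv, hv0]; push_cast; field_simp; ring
    rw [abs_sub_comm, this, abs_of_nonneg (by positivity)]
    gcongr
    nlinarith
  have hsplit : gw k x * F u - gw k y * F v - (gw k x - gw k y) * F v0
      = gw k x * (F u - F v) + (gw k x - gw k y) * (F v - F v0) := by ring
  rw [hsplit]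
  have hA : |gw k x * (F u - F v)| ≤ K * |x - y| * (gw k x * (u * v)) := by
    rw [abs_mul, abs_of_nonneg (gw_nonneg k hx0)]
    calc _ ≤ gw k x * (K * |u - v|) := by
            apply mul_le_mul_of_nonneg_left h1 (gw_nonneg k hx0)
      _ = _ := by rw [huv]; ring
  have hB : |(gw k x - gw k y) * (F v - F v0)| ≤ K * (|gw k x - gw k y| * (k / (k + 1))) := by
    rw [abs_mul]
    calc _ ≤ |gw k x - gw k y| * (K * (k / (k + 1))) := by
            apply mul_le_mul_of_nonneg_left _ (abs_nonneg _)
            exact h2.trans (mul_le_mul_of_nonneg_left hvv hK)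
      _ = _ := by ring
  refine (abs_add_le _ _).trans ((add_le_add hA hB).trans ?_)
  have hKd : 0 ≤ K * |x - y| := mul_nonneg hK (abs_nonneg _)
  rcases Nat.eq_zero_or_pos k with rfl | hkp
  · simp only [Nat.cast_zero, zero_div, mul_zero, add_zero, if_true]
    apply mul_le_mul_of_nonneg_left _ hKd
    have e1 : gw 0 x ≤ 1 / 2 := by
      unfold gw
      rw [div_le_div_iff₀ (by push_cast; positivity) (by norm_num)]
      push_cast
      nlinarith
    have e2 : gw 0 1 = 1 / 3 := by unfold gw; norm_num
    have e3 : u * v ≤ 1 := mul_le_one₀ hmx.2 hmy.1.le hmy.2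
    have e4 := gw_nonneg 0 hx0
    rw [e2]
    nlinarith
  · have hk1 : (1 : ℝ) ≤ k := by exact_mod_cast hkp
    have e3 : u * v ≤ 1 / 4 := by
      have eu : u ≤ 1 / 2 := by
        rw [hu, inv_eq_one_div]; gcongr; linarith
      have ev : v ≤ 1 / 2 := by
        rw [hv, inv_eq_one_div]; gcongr; linarith
      nlinarith [hmx.1, hmy.1]
    have e5 := mul_le_mul_of_nonneg_left (gw_sub_bound' hx hy hkp) hK
    have e6 : gw k x * (u * v) ≤ gw k x / 4 := by
      have := mul_le_mul_of_nonneg_left e3 (gw_nonneg k hx0)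
      linarith
    have e7 := mul_le_mul_of_nonneg_left e6 hKd
    rw [if_neg (by omega)]
    linarith

/-- The observable `-log x`. -/
noncomputable def gphi (x : ℝ) : ℝ := -Real.log x

lemma gphi_measurable : Measurable gphi := Real.measurable_log.neg

lemma gphi_nonneg : ∀ t ∈ Set.Ioc (0 : ℝ) 1, 0 ≤ gphi t := fun t ht => by
  unfold gphi
  have := Real.log_nonpos ht.1.le ht.2
  linarith

lemma summable_log_aux : Summable (fun k : ℕ => Real.log (k + 2) * (4 / ((k : ℝ) + 1) ^ 2)) := by
  have h : Summable (fun k : ℕ => 16 * (1 / ((k + 1 : ℕ) : ℝ) ^ (3 / 2 : ℝ))) := by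
    apply Summable.mul_left
    exact (summable_nat_add_iff 1).2 (Real.summable_one_div_nat_rpow.2 (by norm_num))
  refine Summable.of_nonneg_of_le ?_ ?_ h
  · intro k
    have : (0 : ℝ) ≤ k := Nat.cast_nonneg k
    have := Real.log_nonneg (show (1 : ℝ) ≤ k + 2 by linarith)
    positivity
  · intro k
    have hk : (0 : ℝ) ≤ k := Nat.cast_nonneg k
    have h1 : Real.log (k + 2) ≤ 4 * ((k : ℝ) + 1) ^ (1 / 2 : ℝ) := by
      have a := Real.log_le_rpow_div (show (0 : ℝ) ≤ k + 2 by linarith)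
        (show (0 : ℝ) < 1 / 2 by norm_num)
      have b : ((k : ℝ) + 2) ^ (1 / 2 : ℝ) ≤ 2 * ((k : ℝ) + 1) ^ (1 / 2 : ℝ) := by
        rw [← Real.sqrt_eq_rpow, ← Real.sqrt_eq_rpow]
        rw [Real.sqrt_le_left (by positivity), mul_pow, Real.sq_sqrt (by positivity)]
        linarith
      calc _ ≤ _ := a
        _ ≤ (2 * ((k : ℝ) + 1) ^ (1 / 2 : ℝ)) / (1 / 2) := by gcongr
        _ = _ := by ring
    calc _ ≤ 4 * ((k : ℝ) + 1) ^ (1 / 2 : ℝ) * (4 / ((k : ℝ) + 1) ^ 2) := by gcongr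
      _ = _ := by
        push_cast
        have : ((k : ℝ) + 1) ^ 2 = ((k : ℝ) + 1) ^ (1 / 2 : ℝ) * ((k : ℝ) + 1) ^ (3 / 2 : ℝ) := by
          rw [← Real.rpow_add (by positivity), ← Real.rpow_natCast]; norm_num
        rw [this]
        field_simp
        norm_num

lemma log_le_aux {y : ℝ} (hy : y ∈ Set.Icc (0 : ℝ) 1) (k : ℕ) :
    0 ≤ gphi (y + k + 1)⁻¹ ∧ gphi (y + k + 1)⁻¹ ≤ Real.log (k + 2) := by
  have hk : (0 : ℝ) ≤ k := Nat.cast_nonneg k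
  have hy0 := hy.1
  have hy1 := hy.2
  refine ⟨gphi_nonneg _ (inv_mem hy0 k), ?_⟩
  unfold gphi
  rw [Real.log_inv, neg_neg]
  apply Real.log_le_log (by positivity) (by linarith)

lemma gphi_summable {x : ℝ} (hx : x ∈ Set.Icc (0 : ℝ) 1) :
    Summable (fun k : ℕ => gw k x * gphi (x + k + 1)⁻¹) := by
  have hx0 := hx.1
  have hx1 := hx.2
  refine Summable.of_nonneg_of_le (fun k => mul_nonneg (gw_nonneg k hx.1) (log_le_aux hx k).1) ?_
    summable_log_aux
  intro k
  rw [mul_comm]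
  have hk : (0 : ℝ) ≤ k := Nat.cast_nonneg k
  refine mul_le_mul (log_le_aux hx k).2 ?_ (gw_nonneg k hx0)
    ((log_le_aux hx k).1.trans (log_le_aux hx k).2)
  unfold gw
  rw [pow_two]
  gcongr <;> linarith

lemma gP_gphi_lip : ∃ L : ℝ, 0 ≤ L ∧ LipI (gP gphi) L := by
  refine ⟨1 + ∑' k : ℕ, Real.log (k + 2) * (4 / ((k : ℝ) + 1) ^ 2), ?_, ?_⟩
  · refine add_nonneg zero_le_one (tsum_nonneg fun k => ?_)
    have : (0 : ℝ) ≤ k := Nat.cast_nonneg k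
    have := Real.log_nonneg (show (1 : ℝ) ≤ k + 2 by linarith)
    positivity
  intro x hx y hy
  have hx0 := hx.1
  have hy0 := hy.1
  have sx := (gP_eq hx0 gphi_nonneg (gphi_summable hx)).1
  have sy := (gP_eq hy0 gphi_nonneg (gphi_summable hy)).1
  have hb := ((gw_hasSum hx0).add summable_log_aux.hasSum).mul_right |x - y|
  refine (sx.sub sy).norm_le_of_bounded hb ?_
  intro k
  have hk : (0 : ℝ) ≤ k := Nat.cast_nonneg k
  rw [Real.norm_eq_abs]
  have hsplit : gw k x * gphi (x + k + 1)⁻¹ - gw k y * gphi (y + k + 1)⁻¹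
    = gw k x * (gphi (x + k + 1)⁻¹ - gphi (y + k + 1)⁻¹)
      + (gw k x - gw k y) * gphi (y + k + 1)⁻¹ := by ring
  rw [hsplit, add_mul]
  refine (abs_add_le _ _).trans (add_le_add ?_ ?_)
  · rw [abs_mul, abs_of_nonneg (gw_nonneg k hx0)]
    apply mul_le_mul_of_nonneg_left _ (gw_nonneg k hx0)
    unfold gphi
    rw [Real.log_inv, Real.log_inv, neg_neg, neg_neg]
    have hl : ∀ a b : ℝ, 1 ≤ a → 1 ≤ b → Real.log a - Real.log b ≤ |a - b| := by
      intro a b ha hb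
      rw [← Real.log_div (by positivity) (by positivity)]
      have h1 := Real.log_le_sub_one_of_pos (show 0 < a / b by positivity)
      have h2 : a / b - 1 = (a - b) / b := by field_simp
      rw [h2] at h1
      refine h1.trans ?_
      rw [div_le_iff₀ (by positivity)]
      nlinarith [le_abs_self (a - b), abs_nonneg (a - b)]
    have a1 : 1 ≤ x + k + 1 := by linarith
    have a2 : 1 ≤ y + k + 1 := by linarith
    have e : x + k + 1 - (y + k + 1) = x - y := by ring
    rw [abs_le]
    have b1 := hl _ _ a1 a2
    have b2 := hl _ _ a2 a1
    rw [abs_sub_comm, e] at b2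
    rw [e] at b1
    constructor <;> linarith
  · rw [abs_mul, abs_of_nonneg (log_le_aux hy k).1]
    calc _ ≤ (|x - y| * (4 / (k + 1) ^ 2)) * Real.log (k + 2) :=
          mul_le_mul (gw_sub_bound hx hy) (log_le_aux hy k).2 (log_le_aux hy k).1 (by positivity)
      _ = _ := by ring

lemma gP_iter : ∃ L : ℝ, 0 ≤ L ∧ ∀ n : ℕ, LipI (gP^[n + 1] gphi) (L * (23 / 24) ^ n) := by
  obtain ⟨L, hL, h⟩ := gP_gphi_lip
  refine ⟨L, hL, fun n => ?_⟩
  induction n with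
  | zero => simpa using h
  | succ n ih =>
    rw [Function.iterate_succ_apply']
    have := ih.contract (by positivity) (by
      intro t _
      rw [Function.iterate_succ_apply']
      exact gP_nonneg _ _)
    rw [pow_succ]
    convert this using 1
    ring

/-! ### A strong law for weakly correlated nonnegative variables -/

lemma geom_aux {q : ℝ} (hq0 : 0 ≤ q) (hq1 : q < 1) (n : ℕ) :
    ∑ k ∈ Finset.range n, q ^ (n - k) ≤ 1 / (1 - q) := by
  have h1 : 0 < 1 - q := by linarith
  induction n with
  | zero => simp; linarith
  | succ n ih =>
    rw [Finset.sum_range_succ]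
    have : ∑ k ∈ Finset.range n, q ^ (n + 1 - k) = q * ∑ k ∈ Finset.range n, q ^ (n - k) := by
      rw [Finset.mul_sum]
      apply Finset.sum_congr rfl
      intro k hk
      rw [Finset.mem_range] at hk
      rw [show n + 1 - k = (n - k) + 1 by omega, pow_succ]
      ring
    rw [this]
    have h2 : q * ∑ k ∈ Finset.range n, q ^ (n - k) ≤ q * (1 / (1 - q)) :=
      mul_le_mul_of_nonneg_left ih hq0
    have h3 : q * (1 / (1 - q)) + q ≤ 1 / (1 - q) := by
      rw [← sub_nonneg]
      have : 1 / (1 - q) - (q * (1 / (1 - q)) + q) = 1 - q := by field_simp; ring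
      rw [this]; exact h1.le
    simp only [Nat.add_sub_cancel_left, pow_one]
    linarith

lemma variance_aux {Ω : Type*} [MeasurableSpace Ω] (μ : Measure Ω)
    (Y : ℕ → Ω → ℝ) (hY : ∀ k, MemLp (Y k) 2 μ) (B q : ℝ) (hB : 0 ≤ B) (hq0 : 0 ≤ q) (hq1 : q < 1)
    (hcov : ∀ i j, i ≤ j → ∫ ω, Y i ω * Y j ω ∂μ ≤ B * q ^ (j - i)) (n : ℕ) :
    ∫ ω, (∑ k ∈ Finset.range n, Y k ω) ^ 2 ∂μ ≤ (2 * B / (1 - q) + B) * n := by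
  have h1 : 0 < 1 - q := by linarith
  induction n with
  | zero => simp
  | succ n ih =>
    have hS : MemLp (fun ω => ∑ k ∈ Finset.range n, Y k ω) 2 μ := by
      exact memLp_finsetSum _ (fun k _ => hY k)
    have hij : ∀ i j, Integrable (fun ω => Y i ω * Y j ω) μ := fun i j => (hY i).integrable_mul (hY j)
    have e : ∀ ω, (∑ k ∈ Finset.range (n + 1), Y k ω) ^ 2 =
        (∑ k ∈ Finset.range n, Y k ω) ^ 2 + 2 * (∑ k ∈ Finset.range n, Y k ω * Y n ω)
          + Y n ω * Y n ω := by
      intro ω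
      rw [Finset.sum_range_succ, ← Finset.sum_mul]
      ring
    simp_rw [e]
    have i1 : Integrable (fun ω => ∑ k ∈ Finset.range n, Y k ω * Y n ω) μ :=
      integrable_finsetSum _ (fun k _ => hij k n)
    have i2 : Integrable (fun ω => (∑ k ∈ Finset.range n, Y k ω) ^ 2
        + 2 * (∑ k ∈ Finset.range n, Y k ω * Y n ω)) μ := hS.integrable_sq.add (i1.const_mul 2)
    rw [integral_add i2 (hij n n),
      integral_add hS.integrable_sq (i1.const_mul 2), integral_const_mul,
      integral_finsetSum _ (fun k _ => hij k n)]
    have b1 : ∑ k ∈ Finset.range n, ∫ ω, Y k ω * Y n ω ∂μ ≤ B * (1 / (1 - q)) := by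
      calc _ ≤ ∑ k ∈ Finset.range n, B * q ^ (n - k) :=
            Finset.sum_le_sum (fun k hk => hcov k n (Finset.mem_range.1 hk).le)
        _ ≤ _ := by
          rw [← Finset.mul_sum]
          exact mul_le_mul_of_nonneg_left (geom_aux hq0 hq1 n) hB
    have b2 := hcov n n le_rfl
    simp only [Nat.sub_self, pow_zero, mul_one] at b2
    have e3 : 2 * B / (1 - q) = 2 * (B * (1 / (1 - q))) := by field_simp
    rw [e3] at ih ⊢
    push_cast
    linarith

lemma slln_aux {Ω : Type*} [MeasurableSpace Ω] (μ : Measure Ω) [IsProbabilityMeasure μ]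
    (X : ℕ → Ω → ℝ) (hX : ∀ k, MemLp (X k) 2 μ) (hpos : ∀ᵐ ω ∂μ, ∀ k, 0 ≤ X k ω)
    (c B q : ℝ) (hc : ∀ k, ∫ ω, X k ω ∂μ = c) (hB : 0 ≤ B) (hq0 : 0 ≤ q) (hq1 : q < 1)
    (hcov : ∀ i j, i ≤ j → ∫ ω, X i ω * X j ω ∂μ ≤ c ^ 2 + B * q ^ (j - i)) :
    ∀ᵐ ω ∂μ, Tendsto (fun n : ℕ => (∑ k ∈ Finset.range n, X k ω) / n) atTop (𝓝 c) := by
  have h1 : 0 < 1 - q := by linarith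
  have hI : ∀ k, Integrable (X k) μ := fun k => (hX k).integrable (by norm_num)
  set Y : ℕ → Ω → ℝ := fun k ω => X k ω - c with hYdef
  have hY : ∀ k, MemLp (Y k) 2 μ := fun k => (hX k).sub (memLp_const c)
  have hYcov : ∀ i j, i ≤ j → ∫ ω, Y i ω * Y j ω ∂μ ≤ B * q ^ (j - i) := by
    intro i j hij
    have e : ∀ ω, Y i ω * Y j ω = X i ω * X j ω - (c * X i ω + c * X j ω) + c ^ 2 := by
      intro ω; simp only [hYdef]; ring
    simp_rw [e]
    have hm : Integrable (fun ω => X i ω * X j ω) μ := (hX i).integrable_mul (hX j)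
    have ha : Integrable (fun ω => c * X i ω + c * X j ω) μ :=
      ((hI i).const_mul c).add ((hI j).const_mul c)
    have hd : Integrable (fun ω => X i ω * X j ω - (c * X i ω + c * X j ω)) μ := hm.sub ha
    rw [integral_add hd (integrable_const _), integral_sub hm ha,
      integral_add ((hI i).const_mul c) ((hI j).const_mul c), integral_const_mul,
      integral_const_mul, hc, hc, integral_const]
    simp only [probReal_univ, one_smul]
    have := hcov i j hij
    linarith
  set C := 2 * B / (1 - q) + B with hC
  have hC0 : 0 ≤ C := by positivity
  have hvar := variance_aux μ Y hY B q hB hq0 hq1 hYcov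
  rw [← hC] at hvar
  set W : ℕ → Ω → ℝ := fun n ω => ∑ k ∈ Finset.range n, Y k ω with hW
  have hWL : ∀ n, MemLp (W n) 2 μ := fun n => memLp_finsetSum _ (fun k _ => hY k)
  have hl : ∀ m : ℕ, ∫⁻ ω, ENNReal.ofReal ((W ((m + 1) ^ 2) ω / ((m : ℝ) + 1) ^ 2) ^ 2) ∂μ
      ≤ ENNReal.ofReal (C * (1 / ((m : ℝ) + 1) ^ 2)) := by
    intro m
    have hint : Integrable (fun ω => (W ((m + 1) ^ 2) ω / ((m : ℝ) + 1) ^ 2) ^ 2) μ := by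
      simp_rw [div_pow]
      exact (hWL _).integrable_sq.div_const _
    rw [← ofReal_integral_eq_lintegral_ofReal hint (ae_of_all _ fun ω => sq_nonneg _)]
    apply ENNReal.ofReal_le_ofReal
    simp_rw [div_pow]
    rw [integral_div, div_le_iff₀ (by positivity)]
    refine (hvar _).trans (le_of_eq ?_)
    push_cast
    field_simp
  have hsum : ∫⁻ ω, ∑' m : ℕ, ENNReal.ofReal ((W ((m + 1) ^ 2) ω / ((m : ℝ) + 1) ^ 2) ^ 2) ∂μ
      ≠ ⊤ := by
    rw [lintegral_tsum]
    · have hs : Summable (fun m : ℕ => C * (1 / ((m : ℝ) + 1) ^ 2)) := by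
        apply Summable.mul_left
        have := (summable_nat_add_iff 1).2 (Real.summable_one_div_nat_pow.2 (one_lt_two))
        simpa using this
      refine ne_top_of_le_ne_top ?_ (ENNReal.tsum_le_tsum hl)
      rw [← ENNReal.ofReal_tsum_of_nonneg (fun m => by positivity) hs]
      exact ENNReal.ofReal_ne_top
    · intro m
      have := (hWL ((m + 1) ^ 2)).aestronglyMeasurable.aemeasurable
      exact ((this.div_const _).pow_const 2).ennreal_ofReal
  have hae := ae_lt_top' (AEMeasurable.tsum (fun m => by
      have := (hWL ((m + 1) ^ 2)).aestronglyMeasurable.aemeasurable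
      exact ((this.div_const _).pow_const 2).ennreal_ofReal)) hsum
  filter_upwards [hae, hpos] with ω hω hp
  have t1 := ENNReal.tendsto_atTop_zero_of_tsum_ne_top hω.ne
  have t2 : Tendsto (fun m : ℕ => (W ((m + 1) ^ 2) ω / ((m : ℝ) + 1) ^ 2) ^ 2) atTop (𝓝 0) := by
    have := (ENNReal.tendsto_toReal ENNReal.zero_ne_top).comp t1
    refine this.congr (fun m => ?_)
    simp only [Function.comp]
    rw [ENNReal.toReal_ofReal (sq_nonneg _)]
  have t3 : Tendsto (fun m : ℕ => W ((m + 1) ^ 2) ω / ((m : ℝ) + 1) ^ 2) atTop (𝓝 0) := by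
    have := t2.sqrt
    simp only [Real.sqrt_sq_eq_abs, Real.sqrt_zero] at this
    exact (tendsto_zero_iff_abs_tendsto_zero _).2 this
  apply tendsto_div_of_monotone_of_exists_subseq_tendsto_div
  · apply monotone_nat_of_le_succ
    intro n
    rw [Finset.sum_range_succ]
    linarith [hp n]
  intro a ha
  refine ⟨fun m => (m + 1) ^ 2, ?_, ?_, ?_⟩
  · have hlim : Tendsto (fun m : ℕ => (1 + 1 / ((m : ℝ) + 1)) ^ 2) atTop (𝓝 ((1 + 0) ^ 2)) :=
      (tendsto_one_div_add_atTop_nhds_zero_nat.const_add 1).pow 2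
    rw [add_zero, one_pow] at hlim
    filter_upwards [hlim.eventually_le_const ha] with m hm
    have : (((m + 1 + 1) ^ 2 : ℕ) : ℝ) = (1 + 1 / ((m : ℝ) + 1)) ^ 2 * (((m + 1) ^ 2 : ℕ) : ℝ) := by
      push_cast; field_simp
    rw [this]
    gcongr
  · apply tendsto_atTop_mono (f := fun m : ℕ => m) _ tendsto_id
    intro m
    nlinarith
  · have := t3.add_const c
    rw [zero_add] at this
    refine this.congr (fun m => ?_)
    simp only [hW, hYdef, Finset.sum_sub_distrib, Finset.sum_const, Finset.card_range, nsmul_eq_mul]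
    push_cast
    field_simp
    ring

/-! ### The Gauss measure -/

/-- The Gauss probability measure. -/
noncomputable def gm : Measure ℝ :=
  (volume.restrict (Set.Ioo (0 : ℝ) 1)).withDensity
    (fun x => ENNReal.ofReal ((Real.log 2)⁻¹ * (1 + x)⁻¹))

lemma dens_measurable :
    Measurable (fun x : ℝ => ENNReal.ofReal ((Real.log 2)⁻¹ * (1 + x)⁻¹)) := by
  fun_prop

lemma gaussMap_measurable : Measurable gaussMap := by
  unfold gaussMap
  exact measurable_fract.comp measurable_inv

lemma gm_lintegral {F : ℝ → ENNReal} (hF : Measurable F) :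
    ∫⁻ x, F x ∂gm = ∫⁻ x in Set.Ioo (0 : ℝ) 1,
      ENNReal.ofReal ((Real.log 2)⁻¹ * (1 + x)⁻¹) * F x := by
  unfold gm
  rw [lintegral_withDensity_eq_lintegral_mul _ dens_measurable hF]
  rfl

lemma gm_ae_Ioo : ∀ᵐ x ∂gm, x ∈ Set.Ioo (0 : ℝ) 1 := by
  unfold gm
  exact (withDensity_absolutelyContinuous _ _) (ae_restrict_mem measurableSet_Ioo)

lemma ae_of_gm {p : ℝ → Prop} (h : ∀ᵐ x ∂gm, p x) :
    ∀ᵐ x ∂(volume.restrict (Set.Ioo (0 : ℝ) 1)), p x := by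
  refine (withDensity_absolutelyContinuous' dens_measurable.aemeasurable ?_) h
  filter_upwards [ae_restrict_mem measurableSet_Ioo] with x hx
  have h2 : 0 < Real.log 2 := Real.log_pos one_lt_two
  have hx0 := hx.1
  simp only [ne_eq, ENNReal.ofReal_eq_zero, not_le]
  positivity

lemma lintegral_branches (H : ℝ → ENNReal) :
    ∫⁻ x in Set.Ioo (0 : ℝ) 1, H x = ∑' k : ℕ, ∫⁻ y in Set.Ioo (0 : ℝ) 1,
      ENNReal.ofReal (((y + k + 1) ^ 2)⁻¹) * H (y + k + 1)⁻¹ := by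
  set f : ℕ → ℝ → ℝ := fun k y => (y + k + 1)⁻¹ with hf
  have hinj : ∀ k, Set.InjOn (f k) (Set.Ico 0 1) := by
    intro k a _ b _ hab
    simp only [hf] at hab
    have := inv_injective hab
    linarith
  have hder : ∀ k : ℕ, ∀ y ∈ Set.Ico (0 : ℝ) 1,
      HasDerivWithinAt (f k) (-((y + k + 1) ^ 2)⁻¹) (Set.Ico 0 1) y := by
    intro k y hy
    have hy0 := hy.1
    have h1 : HasDerivAt (fun y : ℝ => y + k + 1) 1 y :=
      ((hasDerivAt_id y).add_const _).add_const _
    have h2 := h1.fun_inv (by positivity)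
    rw [neg_div, one_div] at h2
    exact h2.hasDerivWithinAt
  have hU : ⋃ k, f k '' Set.Ico 0 1 = Set.Ioc 0 1 := by
    ext x
    simp only [Set.mem_iUnion, Set.mem_image]
    constructor
    · rintro ⟨k, y, hy, rfl⟩
      exact inv_mem hy.1 k
    · rintro ⟨hx0, hx1⟩
      have h1 : 1 ≤ ⌊x⁻¹⌋₊ := by
        rw [Nat.one_le_floor_iff]
        exact (one_le_inv₀ hx0).2 hx1
      refine ⟨⌊x⁻¹⌋₊ - 1, x⁻¹ - ⌊x⁻¹⌋₊, ⟨?_, ?_⟩, ?_⟩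
      · rw [sub_nonneg]; exact Nat.floor_le (by positivity)
      · have := Nat.lt_floor_add_one x⁻¹
        linarith
      · simp only [hf]
        rw [Nat.cast_sub h1]
        push_cast
        rw [show x⁻¹ - (⌊x⁻¹⌋₊ : ℝ) + (⌊x⁻¹⌋₊ - 1) + 1 = x⁻¹ by ring, inv_inv]
  have hdisj : Pairwise (Function.onFun Disjoint (fun k => f k '' Set.Ico 0 1)) := by
    intro i j hij
    rw [Function.onFun, Set.disjoint_left]
    rintro x ⟨a, ha, rfl⟩ ⟨b, hb, hab⟩
    apply hij
    simp only [hf] at hab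
    have h := inv_injective hab
    have h3 : (i : ℝ) < j + 1 := by linarith [ha.1, hb.2]
    have h4 : (j : ℝ) < i + 1 := by linarith [ha.2, hb.1]
    have h5 : i < j + 1 := by exact_mod_cast h3
    have h6 : j < i + 1 := by exact_mod_cast h4
    omega
  have hmeas : ∀ k, MeasurableSet (f k '' Set.Ico 0 1) := fun k =>
    measurableSet_Ico.image_of_continuousOn_injOn
      (fun y hy => (hder k y hy).continuousWithinAt) (hinj k)
  rw [setLIntegral_congr (Ioo_ae_eq_Ioc (μ := volume) (a := (0 : ℝ)) (b := 1)), ← hU,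
    lintegral_iUnion hmeas hdisj]
  congr 1
  ext k
  rw [lintegral_image_eq_lintegral_abs_deriv_mul measurableSet_Ico (hder k) (hinj k),
    setLIntegral_congr (Ioo_ae_eq_Ico (μ := volume) (a := (0 : ℝ)) (b := 1))]
  apply setLIntegral_congr_fun measurableSet_Ico
  intro y hy
  simp only [hf, abs_neg]
  rw [abs_of_nonneg (by positivity)]

lemma gm_dual {F G : ℝ → ENNReal} (hF : Measurable F) (hG : Measurable G) :
    ∫⁻ x, F x * G (gaussMap x) ∂gm =
      ∫⁻ x, (∑' k : ℕ, ENNReal.ofReal (gw k x) * F (x + k + 1)⁻¹) * G x ∂gm := by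
  have hgw : ∀ k : ℕ, Measurable (fun x : ℝ => ENNReal.ofReal (gw k x) * F (x + k + 1)⁻¹) := by
    intro k
    refine Measurable.mul ?_ (hF.comp (by fun_prop))
    unfold gw
    fun_prop
  have hm1 : Measurable (fun x => F x * G (gaussMap x)) := hF.mul (hG.comp gaussMap_measurable)
  have hm2 : Measurable (fun x : ℝ =>
      (∑' k : ℕ, ENNReal.ofReal (gw k x) * F (x + k + 1)⁻¹) * G x) := (Measurable.tsum hgw).mul hG
  rw [gm_lintegral hm1, lintegral_branches, gm_lintegral hm2]
  simp_rw [← ENNReal.tsum_mul_right, ← ENNReal.tsum_mul_left]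
  have hm3 : ∀ k : ℕ, Measurable (fun x : ℝ => ENNReal.ofReal ((Real.log 2)⁻¹ * (1 + x)⁻¹)
      * (ENNReal.ofReal (gw k x) * F (x + k + 1)⁻¹ * G x)) :=
    fun k => dens_measurable.mul ((hgw k).mul hG)
  rw [lintegral_tsum (fun k => (hm3 k).aemeasurable)]
  congr 1
  ext k
  apply setLIntegral_congr_fun measurableSet_Ioo
  intro y hy
  have hy0 := hy.1
  have hl : 0 < Real.log 2 := Real.log_pos one_lt_two
  have hT : gaussMap (y + k + 1)⁻¹ = y := by
    unfold gaussMap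
    rw [inv_inv, Int.fract_add_one, Int.fract_add_natCast, Int.fract_eq_self]
    exact ⟨hy.1.le, hy.2⟩
  have hc : ENNReal.ofReal (((y + k + 1) ^ 2)⁻¹)
        * ENNReal.ofReal ((Real.log 2)⁻¹ * (1 + (y + k + 1)⁻¹)⁻¹)
      = ENNReal.ofReal ((Real.log 2)⁻¹ * (1 + y)⁻¹) * ENNReal.ofReal (gw k y) := by
    rw [← ENNReal.ofReal_mul (by positivity), ← ENNReal.ofReal_mul (by positivity)]
    congr 1
    unfold gw
    field_simp
    ring
  simp only [hT]
  rw [← mul_assoc, hc]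
  ring

lemma gw_tsum {x : ℝ} (hx : 0 ≤ x) : ∑' k : ℕ, ENNReal.ofReal (gw k x) = 1 := by
  rw [← ENNReal.ofReal_tsum_of_nonneg (fun k => gw_nonneg k hx) (gw_hasSum hx).summable,
    (gw_hasSum hx).tsum_eq, ENNReal.ofReal_one]

lemma gm_mp : MeasurePreserving gaussMap gm gm := by
  refine ⟨gaussMap_measurable, ?_⟩
  ext s hs
  rw [Measure.map_apply gaussMap_measurable hs]
  have h := gm_dual (F := fun _ => 1) (G := s.indicator 1) measurable_const
    (measurable_one.indicator hs)
  simp only [one_mul, mul_one] at h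
  rw [← lintegral_indicator_one hs, ← lintegral_indicator_one (gaussMap_measurable hs)]
  refine Eq.trans ?_ (h.trans ?_)
  · rfl
  · apply lintegral_congr_ae
    filter_upwards [gm_ae_Ioo] with x hx
    rw [gw_tsum hx.1.le, one_mul]

instance gm_prob : IsProbabilityMeasure gm := by
  constructor
  rw [← lintegral_one, gm_lintegral measurable_const]
  simp only [mul_one]
  have hl : 0 < Real.log 2 := Real.log_pos one_lt_two
  have hc : ContinuousOn (fun x : ℝ => (Real.log 2)⁻¹ * (1 + x)⁻¹) (Set.Icc 0 1) := by
    apply ContinuousOn.mul continuousOn_const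
    apply ContinuousOn.inv₀ (by fun_prop)
    intro x hx
    have := hx.1
    positivity
  have hi : IntegrableOn (fun x : ℝ => (Real.log 2)⁻¹ * (1 + x)⁻¹) (Set.Ioo 0 1) :=
    hc.integrableOn_Icc.mono_set Set.Ioo_subset_Icc_self
  rw [← ofReal_integral_eq_lintegral_ofReal hi]
  · rw [← integral_Ioc_eq_integral_Ioo, ← intervalIntegral.integral_of_le zero_le_one,
      intervalIntegral.integral_const_mul]
    have : ∫ x in (0 : ℝ)..1, (1 + x)⁻¹ = Real.log 2 := by
      rw [intervalIntegral.integral_comp_add_left (fun x : ℝ => x⁻¹) 1,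
        integral_inv_of_pos (by norm_num) (by norm_num)]
      norm_num
    rw [this, inv_mul_cancel₀ hl.ne', ENNReal.ofReal_one]
  · filter_upwards [ae_restrict_mem measurableSet_Ioo] with x hx
    have := hx.1
    simp only [Pi.zero_apply]
    positivity

/-! ### Moments of `-log` -/

lemma integral_pow_log (n : ℕ) :
    IntegrableOn (fun x : ℝ => x ^ n * Real.log x) (Set.Ioo 0 1) ∧
    ∫ x in Set.Ioo (0 : ℝ) 1, x ^ n * Real.log x = -(1 / ((n : ℝ) + 1) ^ 2) := by
  have hi : IntervalIntegrable (fun x : ℝ => x ^ n * Real.log x) volume 0 1 :=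
    intervalIntegral.intervalIntegrable_log'.continuousOn_mul (by fun_prop)
  constructor
  · exact ((intervalIntegrable_iff_integrableOn_Ioc_of_le zero_le_one).1 hi).mono_set
      Set.Ioo_subset_Ioc_self
  rw [← integral_Ioc_eq_integral_Ioo, ← intervalIntegral.integral_of_le zero_le_one]
  have hcont : Continuous (fun x : ℝ => x ^ n * (x * Real.log x) / (n + 1)
      - x ^ (n + 1) / ((n : ℝ) + 1) ^ 2) := by
    have := Real.continuous_mul_log
    fun_prop
  rw [intervalIntegral.integral_eq_sub_of_hasDerivAt_of_le zero_le_one hcont.continuousOn _ hi]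
  · simp
  · intro x hx
    have hx0 := hx.1
    have h1 := (((hasDerivAt_pow (n + 1) x).mul (Real.hasDerivAt_log hx0.ne')).div_const
      ((n : ℝ) + 1)).sub ((hasDerivAt_pow (n + 1) x).div_const (((n : ℝ) + 1) ^ 2))
    refine (h1.congr_deriv ?_).congr_of_eventuallyEq ?_
    · push_cast
      field_simp
      ring
    · apply Eventually.of_forall
      intro y
      simp only [Pi.mul_apply, Pi.sub_apply]
      ring

lemma alt_zeta : HasSum (fun n : ℕ => (-1 : ℝ) ^ n * (1 / ((n : ℝ) + 1) ^ 2)) (π ^ 2 / 12) := by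
  have h0 := hasSum_zeta_two
  have h1 : HasSum (fun n : ℕ => (1 : ℝ) / ((n : ℝ) + 1) ^ 2) (π ^ 2 / 6) := by
    have := (hasSum_nat_add_iff' 1).2 h0
    simpa using this
  have hodd : HasSum (fun k : ℕ => (1 : ℝ) / (((2 * k + 1 : ℕ) : ℝ) + 1) ^ 2) (π ^ 2 / 24) := by
    have h2 := h1.div_const 4
    have e : (fun k : ℕ => (1 : ℝ) / (((2 * k + 1 : ℕ) : ℝ) + 1) ^ 2)
        = fun k : ℕ => (1 : ℝ) / ((k : ℝ) + 1) ^ 2 / 4 := by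
      funext k
      rw [div_div]
      congr 1
      push_cast
      ring
    rw [e, show π ^ 2 / 24 = π ^ 2 / 6 / 4 by ring]
    exact h2
  have hs := h1.summable
  have heven : HasSum (fun k : ℕ => (1 : ℝ) / (((2 * k : ℕ) : ℝ) + 1) ^ 2) (π ^ 2 / 8) := by
    have hinj : Function.Injective (fun k : ℕ => 2 * k) := by
      intro a b h
      have h' : 2 * a = 2 * b := h
      omega
    have hse : Summable (fun k : ℕ => (1 : ℝ) / (((2 * k : ℕ) : ℝ) + 1) ^ 2) :=
      hs.comp_injective hinj
    obtain ⟨e, he⟩ := hse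
    have hu := (HasSum.even_add_odd (f := fun n : ℕ => (1 : ℝ) / ((n : ℝ) + 1) ^ 2) he hodd).unique h1
    have : e = π ^ 2 / 8 := by linarith
    rwa [this] at he
  have : π ^ 2 / 12 = π ^ 2 / 8 + -(π ^ 2 / 24) := by ring
  rw [this]
  apply HasSum.even_add_odd (f := fun n : ℕ => (-1 : ℝ) ^ n * (1 / ((n : ℝ) + 1) ^ 2))
  · have e : (fun k : ℕ => (-1 : ℝ) ^ (2 * k) * (1 / (((2 * k : ℕ) : ℝ) + 1) ^ 2))
        = fun k : ℕ => (1 : ℝ) / (((2 * k : ℕ) : ℝ) + 1) ^ 2 := by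
      funext k
      rw [pow_mul]
      norm_num
    rw [e]
    exact heven
  · have e : (fun k : ℕ => (-1 : ℝ) ^ (2 * k + 1) * (1 / (((2 * k + 1 : ℕ) : ℝ) + 1) ^ 2))
        = fun k : ℕ => -((1 : ℝ) / (((2 * k + 1 : ℕ) : ℝ) + 1) ^ 2) := by
      funext k
      rw [pow_succ, pow_mul]
      norm_num
    rw [e]
    exact hodd.neg

lemma gphi_mean : ∫⁻ x, ENNReal.ofReal (gphi x) ∂gm
    = ENNReal.ofReal (π ^ 2 / (12 * Real.log 2)) := by
  have hl : 0 < Real.log 2 := Real.log_pos one_lt_two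
  rw [gm_lintegral gphi_measurable.ennreal_ofReal]
  have hF : ∀ n : ℕ, Integrable (fun x : ℝ => (-1 : ℝ) ^ n * -(x ^ n * Real.log x))
      (volume.restrict (Set.Ioo 0 1)) := fun n => (integral_pow_log n).1.neg.const_mul _
  have hnorm : ∀ n : ℕ, ∫ x in Set.Ioo (0 : ℝ) 1, ‖(-1 : ℝ) ^ n * -(x ^ n * Real.log x)‖
      = 1 / ((n : ℝ) + 1) ^ 2 := by
    intro n
    rw [← neg_neg (1 / ((n : ℝ) + 1) ^ 2), ← (integral_pow_log n).2, ← integral_neg]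
    apply setIntegral_congr_fun measurableSet_Ioo
    intro x hx
    simp only [norm_mul, norm_neg, norm_pow, norm_one, one_pow, one_mul, Real.norm_eq_abs]
    rw [abs_of_pos hx.1, abs_of_nonpos (Real.log_nonpos hx.1.le hx.2.le)]
    ring
  have hs : Summable (fun n : ℕ => (1 : ℝ) / ((n : ℝ) + 1) ^ 2) := by
    have := (summable_nat_add_iff 1).2 (Real.summable_one_div_nat_pow.2 (one_lt_two))
    simpa using this
  have h := hasSum_integral_of_summable_integral_norm hF (by simp_rw [hnorm]; exact hs)
  have hval : ∀ n : ℕ, ∫ x in Set.Ioo (0 : ℝ) 1, (-1 : ℝ) ^ n * -(x ^ n * Real.log x)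
      = (-1 : ℝ) ^ n * (1 / ((n : ℝ) + 1) ^ 2) := by
    intro n
    rw [integral_const_mul, integral_neg, (integral_pow_log n).2, neg_neg]
  simp_rw [hval] at h
  have hI := h.unique alt_zeta
  have hpt : ∀ x ∈ Set.Ioo (0 : ℝ) 1, ∑' n : ℕ, (-1 : ℝ) ^ n * -(x ^ n * Real.log x)
      = (1 + x)⁻¹ * gphi x := by
    intro x hx
    have hg := (hasSum_geometric_of_abs_lt_one (r := -x)
      (by rw [abs_neg, abs_of_pos hx.1]; exact hx.2)).mul_right (gphi x)
    rw [sub_neg_eq_add] at hg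
    rw [← hg.tsum_eq]
    congr 1
    ext n
    rw [neg_pow, gphi]
    ring
  rw [setIntegral_congr_fun measurableSet_Ioo hpt] at hI
  have hint : Integrable (fun x : ℝ => (1 + x)⁻¹ * gphi x) (volume.restrict (Set.Ioo 0 1)) := by
    by_contra hcon
    rw [integral_undef hcon] at hI
    have : 0 < π ^ 2 / 12 := by positivity
    linarith
  have hlin : ∫⁻ x in Set.Ioo (0 : ℝ) 1,
      ENNReal.ofReal ((Real.log 2)⁻¹ * (1 + x)⁻¹) * ENNReal.ofReal (gphi x)
      = ∫⁻ x in Set.Ioo (0 : ℝ) 1, ENNReal.ofReal ((Real.log 2)⁻¹ * ((1 + x)⁻¹ * gphi x)) := by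
    apply setLIntegral_congr_fun measurableSet_Ioo
    intro x hx
    have := hx.1
    simp only
    rw [← ENNReal.ofReal_mul (by positivity), mul_assoc]
  rw [hlin, ← ofReal_integral_eq_lintegral_ofReal (hint.const_mul _), integral_const_mul, hI]
  · congr 1
    field_simp
  · filter_upwards [ae_restrict_mem measurableSet_Ioo] with x hx
    have h1 := hx.1
    have h2 := gphi_nonneg x ⟨hx.1, hx.2.le⟩
    simp only [Pi.zero_apply]
    positivity

lemma gphi_memLp : MemLp gphi 2 gm := by
  rw [memLp_two_iff_integrable_sq gphi_measurable.aestronglyMeasurable]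
  have hl : 0 < Real.log 2 := Real.log_pos one_lt_two
  have hm : Measurable (fun x => gphi x ^ 2) := gphi_measurable.pow_const 2
  refine ⟨hm.aestronglyMeasurable, ?_⟩
  rw [hasFiniteIntegral_iff_ofReal (ae_of_all _ fun x => sq_nonneg _),
    gm_lintegral hm.ennreal_ofReal]
  have hr : IntegrableOn (fun x : ℝ => (Real.log 2)⁻¹ * (16 * x ^ (-(1 / 2) : ℝ))) (Set.Ioo 0 1) := by
    have h1 : IntervalIntegrable (fun x : ℝ => x ^ (-(1 / 2) : ℝ)) volume 0 1 :=
      intervalIntegral.intervalIntegrable_rpow' (by norm_num)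
    exact ((((intervalIntegrable_iff_integrableOn_Ioc_of_le zero_le_one).1 h1).mono_set
      Set.Ioo_subset_Ioc_self).const_mul _).const_mul _
  refine lt_of_le_of_lt ?_ hr.lintegral_lt_top
  apply setLIntegral_mono' measurableSet_Ioo
  intro x hx
  have hx0 := hx.1
  rw [← ENNReal.ofReal_mul (by positivity)]
  apply ENNReal.ofReal_le_ofReal
  rw [mul_assoc]
  apply mul_le_mul_of_nonneg_left _ (by positivity)
  have ha := Real.abs_log_mul_self_rpow_lt x (1 / 4) hx.1 hx.2.le (by norm_num)
  have hb : (Real.log x * x ^ (1 / 4 : ℝ)) ^ 2 ≤ 16 := by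
    rw [← sq_abs]
    nlinarith [abs_nonneg (Real.log x * x ^ (1 / 4 : ℝ))]
  have hp : (x ^ (1 / 4 : ℝ)) ^ 2 * x ^ (-(1 / 2) : ℝ) = 1 := by
    rw [← Real.rpow_natCast, ← Real.rpow_mul hx0.le, ← Real.rpow_add hx0]
    norm_num
  have hpp : 0 < x ^ (-(1 / 2) : ℝ) := Real.rpow_pos_of_pos hx0 _
  have hc : gphi x ^ 2 ≤ 16 * x ^ (-(1 / 2) : ℝ) := by
    calc gphi x ^ 2 = (Real.log x * x ^ (1 / 4 : ℝ)) ^ 2 * x ^ (-(1 / 2) : ℝ) := by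
          unfold gphi; rw [mul_pow, mul_assoc, hp]; ring
      _ ≤ _ := mul_le_mul_of_nonneg_right hb hpp.le
  refine le_trans ?_ hc
  apply mul_le_of_le_one_left (sq_nonneg _)
  apply inv_le_one_of_one_le₀
  linarith

lemma gphi_nonneg' {x : ℝ} (hx : x ∈ Set.Icc (0 : ℝ) 1) : 0 ≤ gphi x := by
  unfold gphi
  have := Real.log_nonpos hx.1 hx.2
  linarith

/-! ### Correlations -/

lemma gP_iter_dual (n : ℕ) {G : ℝ → ENNReal} (hG : Measurable G) :
    ∫⁻ x, ENNReal.ofReal (gphi x) * G (gaussMap^[n] x) ∂gm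
      = ∫⁻ x, ENNReal.ofReal (gP^[n] gphi x) * G x ∂gm := by
  obtain ⟨L, hL, hlip⟩ := gP_iter
  have hmeas : ∀ n, Measurable (gP^[n] gphi) := by
    intro n
    induction n with
    | zero => exact gphi_measurable
    | succ n ih => rw [Function.iterate_succ_apply']; exact gP_measurable ih
  have hnn : ∀ n, ∀ t ∈ Set.Ioc (0 : ℝ) 1, 0 ≤ gP^[n] gphi t := by
    intro n
    cases n with
    | zero => exact gphi_nonneg
    | succ n => intro t _; rw [Function.iterate_succ_apply']; exact gP_nonneg _ _
  have hsum : ∀ n, ∀ x ∈ Set.Ioo (0 : ℝ) 1,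
      Summable (fun k : ℕ => gw k x * gP^[n] gphi (x + k + 1)⁻¹) := by
    intro n x hx
    cases n with
    | zero => exact gphi_summable ⟨hx.1.le, hx.2.le⟩
    | succ n => exact (hlip n).summable (by positivity) hx.1.le
  induction n generalizing G with
  | zero => rfl
  | succ n ih =>
    have e := ih (G := fun x => G (gaussMap x)) (hG.comp gaussMap_measurable)
    simp only [← Function.iterate_succ_apply'] at e
    rw [e, gm_dual (hmeas n).ennreal_ofReal hG]
    apply lintegral_congr_ae
    filter_upwards [gm_ae_Ioo] with x hx
    congr 1
    rw [Function.iterate_succ_apply', (gP_eq hx.1.le (hnn n) (hsum n x hx)).2]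
    congr 1
    ext k
    rw [ENNReal.ofReal_mul (gw_nonneg k hx.1.le)]

lemma corr_bound : ∃ B : ℝ, 0 ≤ B ∧ ∀ n : ℕ,
    ∫ x, gphi x * gphi (gaussMap^[n] x) ∂gm
      ≤ (π ^ 2 / (12 * Real.log 2)) ^ 2 + B * (23 / 24) ^ n := by
  obtain ⟨L, hL, hlip⟩ := gP_iter
  have hl : 0 < Real.log 2 := Real.log_pos one_lt_two
  set c := π ^ 2 / (12 * Real.log 2) with hc
  have hc0 : 0 ≤ c := by positivity
  set V := ∫ x, gphi x * gphi x ∂gm with hV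
  have hV0 : 0 ≤ V := integral_nonneg (fun x => mul_self_nonneg _)
  refine ⟨V + c * (L * (24 / 23)), by positivity, fun n => ?_⟩
  cases n with
  | zero =>
    simp only [Function.iterate_zero, id, pow_zero, mul_one]
    have : 0 ≤ c * (L * (24 / 23)) := by positivity
    nlinarith [sq_nonneg c]
  | succ n =>
    set h := gP^[n + 1] gphi with hh
    have hn : ∀ t, 0 ≤ h t := by
      intro t; rw [hh, Function.iterate_succ_apply']; exact gP_nonneg _ _
    set d := L * (23 / 24) ^ n with hd
    have hd0 : 0 ≤ d := by positivity
    have hmean : ∫⁻ x, ENNReal.ofReal (h x) ∂gm = ENNReal.ofReal c := by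
      have := gP_iter_dual (n + 1) (G := fun _ => 1) measurable_const
      simp only [mul_one] at this
      rw [← this, gphi_mean]
    have hup : ∀ x ∈ Set.Ioo (0 : ℝ) 1, h x ≤ c + d := by
      intro x hx
      have h1 : ∫⁻ _y, ENNReal.ofReal (h x) ∂gm ≤ ∫⁻ y, (ENNReal.ofReal (h y) + ENNReal.ofReal d) ∂gm := by
        apply lintegral_mono_ae
        filter_upwards [gm_ae_Ioo] with y hy
        rw [← ENNReal.ofReal_add (hn y) hd0]
        apply ENNReal.ofReal_le_ofReal
        have h2 := hlip n x ⟨hx.1.le, hx.2.le⟩ y ⟨hy.1.le, hy.2.le⟩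
        have h3 : |x - y| ≤ 1 := by
          rw [abs_le]; constructor <;> linarith [hx.1, hx.2, hy.1, hy.2]
        have h4 := mul_le_mul_of_nonneg_left h3 hd0
        have h5 := le_abs_self (h x - h y)
        linarith
      rw [lintegral_add_right _ measurable_const, hmean] at h1
      simp only [lintegral_const, measure_univ, mul_one] at h1
      rw [← ENNReal.ofReal_add hc0 hd0] at h1
      exact (ENNReal.ofReal_le_ofReal_iff (by positivity)).1 h1
    have hmT : Measurable (gaussMap^[n + 1]) := gaussMap_measurable.iterate _
    have hTI : ∀ x, gaussMap^[n + 1] x ∈ Set.Icc (0 : ℝ) 1 := by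
      intro x
      rw [Function.iterate_succ_apply']
      exact ⟨Int.fract_nonneg _, (Int.fract_lt_one _).le⟩
    have hle : ∫⁻ x, ENNReal.ofReal (gphi x * gphi (gaussMap^[n + 1] x)) ∂gm
        ≤ ENNReal.ofReal ((c + d) * c) := by
      calc _ = ∫⁻ x, ENNReal.ofReal (gphi x) * ENNReal.ofReal (gphi (gaussMap^[n + 1] x)) ∂gm := by
            apply lintegral_congr
            intro x
            rw [ENNReal.ofReal_mul' (gphi_nonneg' (hTI x))]
        _ = ∫⁻ x, ENNReal.ofReal (h x) * ENNReal.ofReal (gphi x) ∂gm :=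
            gP_iter_dual (n + 1) gphi_measurable.ennreal_ofReal
        _ ≤ ∫⁻ x, ENNReal.ofReal (c + d) * ENNReal.ofReal (gphi x) ∂gm := by
            apply lintegral_mono_ae
            filter_upwards [gm_ae_Ioo] with x hx
            gcongr
            exact hup x hx
        _ = _ := by
            rw [lintegral_const_mul _ gphi_measurable.ennreal_ofReal, gphi_mean,
              ← ENNReal.ofReal_mul (by positivity)]
    rw [integral_eq_lintegral_of_nonneg_ae]
    · refine (ENNReal.toReal_le_of_le_ofReal (by positivity) hle).trans ?_
      have e : (c + d) * c = c ^ 2 + c * (L * (24 / 23)) * (23 / 24) ^ (n + 1) := by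
        rw [hd, pow_succ]; ring
      rw [e]
      have : 0 ≤ V * (23 / 24) ^ (n + 1) := by positivity
      linarith
    · filter_upwards [gm_ae_Ioo] with x hx
      exact mul_nonneg (gphi_nonneg' ⟨hx.1.le, hx.2.le⟩) (gphi_nonneg' (hTI x))
    · exact (gphi_measurable.mul (gphi_measurable.comp hmT)).aestronglyMeasurable

lemma birkhoff_gphi : ∀ᵐ x ∂gm,
    Tendsto (fun n : ℕ => (∑ k ∈ Finset.range n, gphi (gaussMap^[k] x)) / n) atTop
      (𝓝 (π ^ 2 / (12 * Real.log 2))) := by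
  obtain ⟨B, hB, hcov⟩ := corr_bound
  have hmp : ∀ k, MeasurePreserving (gaussMap^[k]) gm gm := fun k => gm_mp.iterate k
  have hc0 : 0 ≤ π ^ 2 / (12 * Real.log 2) := by
    have := Real.log_pos one_lt_two
    positivity
  refine slln_aux gm (fun k x => gphi (gaussMap^[k] x)) ?_ ?_ _ B (23 / 24) ?_ hB (by norm_num)
    (by norm_num) ?_
  · intro k
    exact gphi_memLp.comp_measurePreserving (hmp k)
  · filter_upwards [gm_ae_Ioo] with x hx k
    cases k with
    | zero => exact gphi_nonneg' ⟨hx.1.le, hx.2.le⟩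
    | succ k =>
      rw [Function.iterate_succ_apply']
      exact gphi_nonneg' ⟨Int.fract_nonneg _, (Int.fract_lt_one _).le⟩
  · intro k
    have h1 : ∫ x, gphi (gaussMap^[k] x) ∂gm = ∫ x, gphi x ∂gm := by
      have := integral_map (μ := gm) (hmp k).measurable.aemeasurable
        (f := gphi) gphi_measurable.aestronglyMeasurable
      rw [(hmp k).map_eq] at this
      exact this.symm
    rw [h1, integral_eq_lintegral_of_nonneg_ae _ gphi_measurable.aestronglyMeasurable, gphi_mean,
      ENNReal.toReal_ofReal hc0]
    filter_upwards [gm_ae_Ioo] with x hx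
    exact gphi_nonneg' ⟨hx.1.le, hx.2.le⟩
  · intro i j hij
    obtain ⟨n, rfl⟩ := Nat.exists_eq_add_of_le hij
    rw [Nat.add_sub_cancel_left]
    refine le_trans (le_of_eq ?_) (hcov n)
    have hm : Measurable (fun x => gphi x * gphi (gaussMap^[n] x)) :=
      gphi_measurable.mul (gphi_measurable.comp (gaussMap_measurable.iterate n))
    have := integral_map (μ := gm) (hmp i).measurable.aemeasurable
        (f := fun x => gphi x * gphi (gaussMap^[n] x)) hm.aestronglyMeasurable
    rw [(hmp i).map_eq] at this
    rw [this]
    congr 1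
    ext x
    rw [add_comm i n, Function.iterate_add_apply]

/-- **Lévy's theorem**: for almost every `x ∈ (0,1)`,
`(log qₙ)/n → π²/(12 log 2)`. -/
theorem levy_log_denominator :
    ∀ᵐ x ∂(volume.restrict (Set.Ioo (0 : ℝ) 1)),
      Tendsto (fun n : ℕ => Real.log (cfQ x n) / n) atTop
        (𝓝 (π ^ 2 / (12 * Real.log 2))) := by
  have hirr : ∀ᵐ x ∂(volume.restrict (Set.Ioo (0 : ℝ) 1)), Irrational x := by
    apply ae_restrict_of_ae
    have : (Set.range ((↑) : ℚ → ℝ)).Countable := Set.countable_range _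
    exact this.ae_notMem volume
  filter_upwards [ae_of_gm birkhoff_gphi, hirr, ae_restrict_mem measurableSet_Ioo] with x h1 h2 h3
  have hz : Tendsto (fun n : ℕ => (Real.log (cfQ x n)
      - ∑ k ∈ Finset.range n, gphi (gaussMap^[k] x)) / n) atTop (𝓝 0) := by
    apply squeeze_zero_norm (a := fun n : ℕ => Real.log 2 / n)
    · intro n
      rw [norm_div, Real.norm_eq_abs, Real.norm_natCast]
      gcongr
      exact log_cfQ_near h2 h3 n
    · exact tendsto_const_div_atTop_nhds_zero_nat _
  have := hz.add h1
  rw [zero_add] at this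
  refine this.congr (fun n => ?_)
  ring
end

section
/- For almost every x ∈ (0,1), the limit lim_{n→∞} (1/n)·log |x − p_n/q_n| exists and equals −π²/(6·log 2), where p_n/q_n are the continued fraction convergents of x. -/
open Filter MeasureTheory Real Topology

namespace Levy

/-- branch weights -/
noncomputable def pk (k : ℕ) (y : ℝ) : ℝ := (1 + y) / ((k + 1 + y) * (k + 2 + y))

/-- inverse branches -/
noncomputable def br (k : ℕ) (y : ℝ) : ℝ := ((k : ℝ) + 1 + y)⁻¹

/-- transfer operator -/
noncomputable def U (g : ℝ → ℝ) (y : ℝ) : ℝ := ∑' k : ℕ, pk k y * g (br k y)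

lemma pk_nonneg (k : ℕ) {y : ℝ} (hy : 0 ≤ y) : 0 ≤ pk k y := by
  unfold pk; positivity

lemma br_mem (k : ℕ) {y : ℝ} (hy : 0 ≤ y) : br k y ∈ Set.Ioc (0 : ℝ) 1 := by
  unfold br
  constructor
  · positivity
  · apply inv_le_one_of_one_le₀
    have : (0 : ℝ) ≤ k := Nat.cast_nonneg k
    linarith

lemma pk_hasSum {y : ℝ} (hy : 0 ≤ y) : HasSum (fun k => pk k y) 1 := by
  rw [hasSum_iff_tendsto_nat_of_nonneg (fun k => pk_nonneg k hy)]
  have h : ∀ n : ℕ, ∑ k ∈ Finset.range n, pk k y = 1 - (1 + y) * ((n : ℝ) + 1 + y)⁻¹ := by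
    intro n
    induction n with
    | zero => simp; field_simp; ring
    | succ n ih =>
      rw [Finset.sum_range_succ, ih]
      unfold pk
      push_cast
      have h1 : (n : ℝ) + 1 + y ≠ 0 := by positivity
      have h2 : (n : ℝ) + 2 + y ≠ 0 := by positivity
      have h3 : (n : ℝ) + 1 + 1 + y ≠ 0 := by positivity
      field_simp
      ring
  simp_rw [h]
  have h0 : Tendsto (fun n : ℕ => ((n : ℝ) + 1 + y)⁻¹) atTop (𝓝 0) := by
    apply tendsto_inv_atTop_zero.comp
    simp_rw [add_assoc]
    exact tendsto_atTop_add_const_right _ _ tendsto_natCast_atTop_atTop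
  simpa using (h0.const_mul (1 + y)).const_sub 1

/-- growth condition -/
def Gr (g : ℝ → ℝ) : Prop := ∃ C, 0 ≤ C ∧ ∀ u ∈ Set.Ioc (0 : ℝ) 1, |g u| ≤ C * √(u⁻¹)

lemma summable_pk {g : ℝ → ℝ} (hg : Gr g) {x y : ℝ} (hx : x ∈ Set.Icc (0 : ℝ) 1)
    (hy : y ∈ Set.Icc (0 : ℝ) 1) : Summable (fun k => pk k x * g (br k y)) := by
  obtain ⟨C, hC, hg⟩ := hg
  have hs : Summable (fun k : ℕ => 2 * C * (((k + 1 : ℕ) : ℝ) ^ (-(3 / 2) : ℝ))) := by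
    apply Summable.mul_left
    exact (summable_nat_add_iff 1).2 (Real.summable_nat_rpow.2 (by norm_num))
  refine Summable.of_norm_bounded hs ?_
  intro k
  rw [Real.norm_eq_abs, abs_mul, abs_of_nonneg (pk_nonneg k hx.1)]
  have hb := hg _ (br_mem k hy.1)
  have hk : (0 : ℝ) ≤ k := Nat.cast_nonneg k
  have h1 : √((br k y)⁻¹) ≤ √((k : ℝ) + 2) := by
    apply Real.sqrt_le_sqrt
    unfold br
    rw [inv_inv]
    linarith [hy.2]
  have h2 : pk k x ≤ 2 / ((k + 1) * (k + 2)) := by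
    unfold pk
    apply div_le_div₀ (by norm_num) (by linarith [hx.2]) (by positivity)
    apply mul_le_mul (by linarith [hx.1]) (by linarith [hx.1]) (by positivity)
    linarith [hx.1]
  have h3 : (((k + 1 : ℕ) : ℝ) ^ (-(3 / 2) : ℝ)) = 1 / ((k + 1) * √((k : ℝ) + 1)) := by
    push_cast
    rw [show (-(3 / 2) : ℝ) = -(1 + 1 / 2) by norm_num, Real.rpow_neg (by positivity),
      Real.rpow_add (by positivity), Real.rpow_one, ← Real.sqrt_eq_rpow, one_div]
  have h4 : √((k : ℝ) + 2) / (k + 2) ≤ 1 / √((k : ℝ) + 1) := by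
    rw [div_le_div_iff₀ (by positivity) (by positivity), ← Real.sqrt_mul (by positivity), one_mul]
    apply Real.sqrt_le_iff.2
    constructor
    · positivity
    · nlinarith
  calc pk k x * |g (br k y)| ≤ (2 / ((k + 1) * (k + 2))) * (C * √((k : ℝ) + 2)) := by
        apply mul_le_mul h2 _ (abs_nonneg _) (by positivity)
        exact hb.trans (mul_le_mul_of_nonneg_left h1 hC)
    _ = 2 * C * (1 / (k + 1)) * (√((k : ℝ) + 2) / (k + 2)) := by
        field_simp
    _ ≤ 2 * C * (1 / (k + 1)) * (1 / √((k : ℝ) + 1)) := by gcongr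
    _ = _ := by rw [h3]; field_simp

lemma U_le_of_antitone {g : ℝ → ℝ} (hg : Gr g) (ha : AntitoneOn g (Set.Ioc 0 1)) {x y : ℝ}
    (hx : x ∈ Set.Icc (0 : ℝ) 1) (hy : y ∈ Set.Icc (0 : ℝ) 1) (hxy : x ≤ y) :
    U g x ≤ U g y := by
  have s1 := summable_pk hg hx hx
  have s2 := summable_pk hg hx hy
  have s3 := summable_pk hg hy hy
  have hx0 := hx.1
  have hy0 := hy.1
  have step1 : U g x ≤ ∑' k, pk k x * g (br k y) := by
    refine Summable.tsum_le_tsum ?_ s1 s2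
    intro k
    refine mul_le_mul_of_nonneg_left ?_ (pk_nonneg k hx0)
    refine ha (br_mem k hy0) (br_mem k hx0) ?_
    unfold br
    gcongr
  refine step1.trans ?_
  have hsum : HasSum (fun k => (pk k y - pk k x) * (g (br k y) - g (br 1 y)))
      ((∑' k, pk k y * g (br k y)) - (∑' k, pk k x * g (br k y)) - (1 * g (br 1 y) - 1 * g (br 1 y))) := by
    have hh := (s3.hasSum.sub s2.hasSum).sub
      (((pk_hasSum hy0).mul_right (g (br 1 y))).sub ((pk_hasSum hx0).mul_right (g (br 1 y))))
    have he : (fun k => (pk k y - pk k x) * (g (br k y) - g (br 1 y))) = fun k =>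
        pk k y * g (br k y) - pk k x * g (br k y) -
          (pk k y * g (br 1 y) - pk k x * g (br 1 y)) := by
      funext k
      ring
    rw [he]
    exact hh
  have hnn : 0 ≤ (∑' k, pk k y * g (br k y)) - (∑' k, pk k x * g (br k y))
      - (1 * g (br 1 y) - 1 * g (br 1 y)) := by
    refine hsum.nonneg ?_
    intro k
    have hd : pk k y - pk k x = (y - x) * (((k : ℝ) + 1) ^ 2 - (k + 1) - (1 + x) * (1 + y)) /
        (((k + 1 + y) * (k + 2 + y)) * ((k + 1 + x) * (k + 2 + x))) := by
      unfold pk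
      rw [div_sub_div _ _ (by positivity) (by positivity)]
      congr 1
      ring
    rcases Nat.lt_trichotomy k 1 with h | h | h
    · have hk : k = 0 := by omega
      apply mul_nonneg_of_nonpos_of_nonpos
      · rw [hd, hk]
        apply div_nonpos_of_nonpos_of_nonneg
        · apply mul_nonpos_of_nonneg_of_nonpos (by linarith)
          push_cast
          nlinarith
        · positivity
      · rw [sub_nonpos]
        refine ha (br_mem 1 hy0) (br_mem k hy0) ?_
        rw [hk]
        unfold br
        push_cast
        gcongr
        norm_num
    · simp [h]
    · apply mul_nonneg
      · rw [hd]
        apply div_nonneg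
        · apply mul_nonneg (by linarith)
          have : (2 : ℝ) ≤ k := by exact_mod_cast h
          nlinarith [hx.2, hy.2]
        · positivity
      · rw [sub_nonneg]
        refine ha (br_mem k hy0) (br_mem 1 hy0) ?_
        unfold br
        have : (1 : ℝ) ≤ k := by exact_mod_cast h.le
        push_cast
        gcongr
  unfold U
  linarith

lemma U_neg (g : ℝ → ℝ) : U (fun x => - g x) = fun y => - U g y := by
  funext y
  unfold U
  rw [← tsum_neg]
  congr 1
  funext k
  ring

lemma Gr.neg {g : ℝ → ℝ} (h : Gr g) : Gr (fun x => - g x) := by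
  obtain ⟨C, hC, h⟩ := h
  exact ⟨C, hC, by simpa using h⟩

lemma Gr.of_bdd {g : ℝ → ℝ} {M : ℝ} (h : ∀ u ∈ Set.Icc (0 : ℝ) 1, |g u| ≤ M) : Gr g := by
  have hM : 0 ≤ M := (abs_nonneg _).trans (h 0 (by simp))
  refine ⟨M, hM, fun u hu => (h u ⟨hu.1.le, hu.2⟩).trans ?_⟩
  apply le_mul_of_one_le_right hM
  rw [Real.one_le_sqrt]
  exact (one_le_inv₀ hu.1).2 hu.2

lemma Gr.of_antitone {g : ℝ → ℝ} (ha : AntitoneOn g (Set.Icc 0 1)) : Gr g := by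
  apply Gr.of_bdd (M := max |g 0| |g 1|)
  intro u hu
  exact abs_le_max_abs_abs (ha hu (by simp) hu.2) (ha (by simp) hu hu.1) |>.trans
    (by rw [max_comm])

lemma U_osc {g : ℝ → ℝ} (ha : AntitoneOn g (Set.Icc 0 1)) :
    U g 1 - U g 0 ≤ (g 0 - g 1) / 2 := by
  have hg := Gr.of_antitone ha
  have s0 := summable_pk hg (x := 0) (y := 0) (by simp) (by simp)
  have s1 := summable_pk hg (x := 1) (y := 1) (by simp) (by simp)
  have e0 : U g 0 = 1 / 2 * g 1 + ∑' k, pk (k + 1) 0 * g (br (k + 1) 0) := by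
    unfold U
    rw [s0.tsum_eq_zero_add]
    congr 1
    unfold pk br
    norm_num
  have s0' := (summable_nat_add_iff 1).2 s0
  have hp := pk_hasSum (y := 1) (by norm_num)
  have hle : U g 1 - ∑' k, pk (k + 1) 0 * g (br (k + 1) 0) ≤ 1 / 2 * g 0 := by
    unfold U
    rw [← s1.tsum_sub s0']
    have : HasSum (fun k => pk k 1 / 2 * g 0) (1 / 2 * g 0) := (hp.div_const 2).mul_right (g 0)
    rw [← this.tsum_eq]
    refine (s1.sub s0').tsum_le_tsum ?_ this.summable
    intro k
    have hb : br (k + 1) 0 = br k 1 := by unfold br; push_cast; ring_nf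
    have hpk : pk (k + 1) 0 = pk k 1 / 2 := by
      unfold pk; push_cast
      rw [div_div]
      rw [div_eq_div_iff (by positivity) (by positivity)]
      ring
    rw [hb, hpk]
    have hm := br_mem k (y := 1) (by norm_num)
    have := ha (a := 0) (b := br k 1) (by simp) ⟨hm.1.le, hm.2⟩ hm.1.le
    have h2 := pk_nonneg k (y := 1) (by norm_num)
    nlinarith
  rw [e0]
  linarith

/-- monotone of either sign with oscillation at most `v` -/
def Osc (g : ℝ → ℝ) (v : ℝ) : Prop :=
  (AntitoneOn g (Set.Icc 0 1) ∧ g 0 - g 1 ≤ v) ∨ (MonotoneOn g (Set.Icc 0 1) ∧ g 1 - g 0 ≤ v)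

lemma Osc.gr {g : ℝ → ℝ} {v : ℝ} (h : Osc g v) : Gr g := by
  rcases h with h | h
  · exact Gr.of_antitone h.1
  · have := (Gr.of_antitone h.1.neg).neg
    simpa using this

lemma Osc.U {g : ℝ → ℝ} {v : ℝ} (h : Osc g v) : Osc (U g) (v / 2) := by
  rcases h with h | h
  · right
    refine ⟨fun x hx y hy hxy => U_le_of_antitone (Gr.of_antitone h.1)
      (h.1.mono Set.Ioc_subset_Icc_self) hx hy hxy, ?_⟩
    have := U_osc h.1
    linarith [h.2]
  · left
    have ha : AntitoneOn (fun x => - g x) (Set.Icc 0 1) := h.1.neg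
    refine ⟨fun x hx y hy hxy => ?_, ?_⟩
    · have := U_le_of_antitone (Gr.of_antitone ha)
        (ha.mono Set.Ioc_subset_Icc_self) hx hy hxy
      rw [U_neg] at this
      simpa using this
    · have := U_osc ha
      rw [U_neg] at this
      linarith [h.2]

lemma Osc.le {g : ℝ → ℝ} {v : ℝ} (h : Osc g v) {x y : ℝ} (hx : x ∈ Set.Icc (0 : ℝ) 1)
    (hy : y ∈ Set.Icc (0 : ℝ) 1) : g x ≤ g y + v := by
  rcases h with h | h
  · have h1 := h.1 (by simp) hx hx.1
    have h2 := h.1 hy (by simp) hy.2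
    linarith [h.2]
  · have h1 := h.1 hx (by simp) hx.2
    have h2 := h.1 (by simp) hy hy.1
    linarith [h.2]

/-- the observable -/
noncomputable def lf (x : ℝ) : ℝ := - Real.log x

lemma lf_nonneg {x : ℝ} (hx : x ∈ Set.Ioc (0 : ℝ) 1) : 0 ≤ lf x := by
  unfold lf
  linarith [Real.log_nonpos hx.1.le hx.2]

lemma lf_le {x : ℝ} (hx : 0 < x) {e : ℝ} (he : 0 < e) : lf x ≤ (x⁻¹) ^ e / e := by
  unfold lf
  rw [← Real.log_inv]
  exact Real.log_le_rpow_div (by positivity) he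

lemma lf_gr : Gr lf := by
  refine ⟨2, by norm_num, fun u hu => ?_⟩
  rw [abs_of_nonneg (lf_nonneg hu), Real.sqrt_eq_rpow]
  have := lf_le hu.1 (e := 1 / 2) (by norm_num)
  linarith

lemma lf_anti : AntitoneOn lf (Set.Ioc 0 1) := by
  intro x hx y hy hxy
  unfold lf
  simpa using Real.log_le_log hx.1 hxy

lemma Ulf_osc : Osc (U lf) (U lf 1 - U lf 0) :=
  Or.inr ⟨fun _ hx _ hy hxy => U_le_of_antitone lf_gr lf_anti hx hy hxy, le_rfl⟩

lemma U_iter_osc (m : ℕ) : Osc (U^[m + 1] lf) ((U lf 1 - U lf 0) / 2 ^ m) := by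
  induction m with
  | zero => simpa using Ulf_osc
  | succ m ih =>
    rw [Function.iterate_succ_apply']
    have := ih.U
    rwa [div_div, ← pow_succ] at this

lemma U_iter_nonneg (m : ℕ) : ∀ u ∈ Set.Ioc (0 : ℝ) 1, 0 ≤ U^[m] lf u := by
  induction m with
  | zero => intro u hu; exact lf_nonneg hu
  | succ m ih =>
    intro u hu
    rw [Function.iterate_succ_apply']
    exact tsum_nonneg fun k => mul_nonneg (pk_nonneg k hu.1.le) (ih _ (br_mem k hu.1.le))

lemma U_iter_gr (m : ℕ) : Gr (U^[m] lf) := by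
  cases m with
  | zero => exact lf_gr
  | succ m => exact (U_iter_osc m).gr

open ENNReal in
/-- transfer operator on nonnegative extended functions -/
noncomputable def UE (g : ℝ → ℝ≥0∞) (y : ℝ) : ℝ≥0∞ :=
  ∑' k : ℕ, ENNReal.ofReal (pk k y) * g (br k y)

lemma measurable_pk (k : ℕ) : Measurable (pk k) := by
  unfold pk; fun_prop

lemma measurable_br (k : ℕ) : Measurable (br k) := by
  unfold br; fun_prop

lemma UE_measurable {g : ℝ → ENNReal} (hg : Measurable g) : Measurable (UE g) := by
  unfold UE
  refine Measurable.tsum fun k => ?_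
  exact (measurable_pk k).ennreal_ofReal.mul (hg.comp (measurable_br k))

lemma UE_iter_measurable {g : ℝ → ENNReal} (hg : Measurable g) (m : ℕ) :
    Measurable (UE^[m] g) := by
  induction m with
  | zero => exact hg
  | succ m ih => rw [Function.iterate_succ_apply']; exact UE_measurable ih

lemma UE_iter_eq (m : ℕ) : ∀ u ∈ Set.Ioc (0 : ℝ) 1,
    UE^[m] (fun x => ENNReal.ofReal (lf x)) u = ENNReal.ofReal (U^[m] lf u) := by
  induction m with
  | zero => intro u hu; rfl
  | succ m ih =>
    intro u hu
    rw [Function.iterate_succ_apply', Function.iterate_succ_apply']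
    have hu' : u ∈ Set.Icc (0 : ℝ) 1 := ⟨hu.1.le, hu.2⟩
    change ∑' k : ℕ, ENNReal.ofReal (pk k u) * UE^[m] (fun x => ENNReal.ofReal (lf x)) (br k u) =
      ENNReal.ofReal (∑' k : ℕ, pk k u * U^[m] lf (br k u))
    rw [ENNReal.ofReal_tsum_of_nonneg (fun k => mul_nonneg (pk_nonneg k hu.1.le)
      (U_iter_nonneg m _ (br_mem k hu.1.le))) (summable_pk (U_iter_gr m) hu' hu')]
    congr 1
    funext k
    rw [ih _ (br_mem k hu.1.le), ENNReal.ofReal_mul (pk_nonneg k hu.1.le)]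

lemma measurable_gaussMap : Measurable gaussMap := by
  unfold gaussMap
  exact measurable_inv.fract

lemma gaussMap_br (k : ℕ) {y : ℝ} (hy : y ∈ Set.Ioo (0 : ℝ) 1) : gaussMap (br k y) = y := by
  unfold gaussMap br
  rw [inv_inv]
  have : ((k : ℝ) + 1 + y) = ((k + 1 : ℕ) : ℝ) + y := by push_cast; ring
  rw [this, Int.fract_natCast_add]
  exact Int.fract_eq_self.2 ⟨hy.1.le, hy.2⟩

lemma floor_br (k : ℕ) {y : ℝ} (hy : y ∈ Set.Ioo (0 : ℝ) 1) : ⌊(br k y)⁻¹⌋ = (k : ℤ) + 1 := by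
  unfold br
  rw [inv_inv, Int.floor_eq_iff]
  push_cast
  constructor <;> linarith [hy.1, hy.2]

lemma lintegral_branches (F : ℝ → ENNReal) (hF : Measurable F) :
    ∫⁻ x in Set.Ioo (0 : ℝ) 1, F x =
      ∫⁻ y in Set.Ioo (0 : ℝ) 1, ∑' k : ℕ, ENNReal.ofReal ((br k y) ^ 2) * F (br k y) := by
  have hder : ∀ k : ℕ, ∀ y ∈ Set.Ioo (0 : ℝ) 1,
      HasDerivWithinAt (br k) (-(br k y) ^ 2) (Set.Ioo 0 1) y := by
    intro k y hy
    have h1 : HasDerivAt (fun y : ℝ => (k : ℝ) + 1 + y) 1 y := (hasDerivAt_id y).const_add _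
    have hne : (k : ℝ) + 1 + y ≠ 0 := by have := hy.1; positivity
    have h2 := (h1.inv hne).hasDerivWithinAt (s := Set.Ioo 0 1)
    refine HasDerivWithinAt.congr_deriv h2 ?_
    unfold br
    field_simp
  have hinj : ∀ k : ℕ, Set.InjOn (br k) (Set.Ioo 0 1) := by
    intro k x hx y hy hxy
    rw [← gaussMap_br k hx, ← gaussMap_br k hy, hxy]
  have hms : ∀ k : ℕ, MeasurableSet (br k '' Set.Ioo 0 1) := fun k =>
    measurableSet_Ioo.image_of_measurable_injOn (measurable_br k) (hinj k)
  have hdisj : Pairwise (Function.onFun Disjoint fun k : ℕ => br k '' Set.Ioo (0 : ℝ) 1) := by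
    intro i j hij
    rw [Function.onFun, Set.disjoint_left]
    rintro _ ⟨x, hx, rfl⟩ ⟨y, hy, hxy⟩
    apply hij
    have h1 := floor_br i hx
    have h2 := floor_br j hy
    rw [hxy] at h2
    omega
  have hae : Set.Ioo (0 : ℝ) 1 =ᵐ[volume] ⋃ k : ℕ, br k '' Set.Ioo (0 : ℝ) 1 := by
    have hsub : (⋃ k : ℕ, br k '' Set.Ioo (0 : ℝ) 1) ⊆ Set.Ioo 0 1 := by
      intro u hu
      obtain ⟨k, y, hy, rfl⟩ := Set.mem_iUnion.1 hu
      refine ⟨(br_mem k hy.1.le).1, ?_⟩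
      unfold br
      apply inv_lt_one_of_one_lt₀
      have : (0 : ℝ) ≤ k := Nat.cast_nonneg k
      linarith [hy.1]
    have hnull : volume (Set.range (fun z : ℤ => ((z : ℝ))⁻¹)) = 0 :=
      (Set.countable_range _).measure_zero _
    refine (ae_le_set.2 ?_).antisymm (LE.le.eventuallyLE hsub)
    refine measure_mono_null ?_ hnull
    rintro u ⟨hu, hn⟩
    by_contra hr
    apply hn
    have hinv : 1 < u⁻¹ := (one_lt_inv₀ hu.1).2 hu.2
    have hfl : 1 ≤ ⌊u⁻¹⌋ := Int.le_floor.2 (by simpa using hinv.le)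
    obtain ⟨k, hk⟩ := Int.eq_ofNat_of_zero_le (show 0 ≤ ⌊u⁻¹⌋ - 1 by omega)
    have hk' : (⌊u⁻¹⌋ : ℝ) = k + 1 := by
      have : ⌊u⁻¹⌋ = (k : ℤ) + 1 := by omega
      rw [this]; push_cast; ring
    refine Set.mem_iUnion.2 ⟨k, Int.fract u⁻¹, ⟨?_, Int.fract_lt_one _⟩, ?_⟩
    · rcases (Int.fract_nonneg u⁻¹).lt_or_eq with h | h
      · exact h
      · exfalso
        apply hr
        refine ⟨⌊u⁻¹⌋, ?_⟩
        have := Int.floor_add_fract u⁻¹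
        rw [← h, add_zero] at this
        simp only
        rw [this, inv_inv]
    · unfold br
      rw [← hk', Int.floor_add_fract, inv_inv]
  rw [setLIntegral_congr hae, lintegral_iUnion hms hdisj, lintegral_tsum]
  · congr 1
    funext k
    rw [lintegral_image_eq_lintegral_abs_deriv_mul measurableSet_Ioo (hder k) (hinj k)]
    simp
  · intro k
    exact (((measurable_br k).pow_const 2).ennreal_ofReal.mul
      (hF.comp (measurable_br k))).aemeasurable

/-- Gauss density -/
noncomputable def rho (x : ℝ) : ENNReal := ENNReal.ofReal ((Real.log 2)⁻¹ * (1 + x)⁻¹)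

lemma measurable_rho : Measurable rho := by
  unfold rho; fun_prop

/-- Gauss measure -/
noncomputable def gm : Measure ℝ := (volume.restrict (Set.Ioo (0 : ℝ) 1)).withDensity rho

lemma lintegral_gm (F : ℝ → ENNReal) (hF : Measurable F) :
    ∫⁻ x, F x ∂gm = ∫⁻ x in Set.Ioo (0 : ℝ) 1, rho x * F x := by
  unfold gm
  rw [lintegral_withDensity_eq_lintegral_mul _ measurable_rho hF]
  rfl

lemma ae_gm_iff (P : ℝ → Prop) :
    (∀ᵐ x ∂gm, P x) ↔ ∀ᵐ x ∂(volume.restrict (Set.Ioo (0 : ℝ) 1)), P x := by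
  have h1 : gm ≪ volume.restrict (Set.Ioo (0 : ℝ) 1) := withDensity_absolutelyContinuous _ _
  have h2 : volume.restrict (Set.Ioo (0 : ℝ) 1) ≪ gm := by
    refine withDensity_absolutelyContinuous' measurable_rho.aemeasurable ?_
    refine (ae_restrict_iff' measurableSet_Ioo).2 (Eventually.of_forall fun x hx => ?_)
    unfold rho
    have : 0 < Real.log 2 := Real.log_pos (by norm_num)
    have := hx.1
    simp only [ne_eq, ENNReal.ofReal_eq_zero, not_le]
    positivity
  exact ⟨fun h => h2.ae_le h, fun h => h1.ae_le h⟩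

lemma transfer (g h : ℝ → ENNReal) (hg : Measurable g) (hh : Measurable h) :
    ∫⁻ x, g x * h (gaussMap x) ∂gm = ∫⁻ x, UE g x * h x ∂gm := by
  have hF : Measurable fun x => g x * h (gaussMap x) := hg.mul (hh.comp measurable_gaussMap)
  rw [lintegral_gm _ hF, lintegral_gm (fun x => UE g x * h x) ((UE_measurable hg).mul hh),
    lintegral_branches (fun x => rho x * (g x * h (gaussMap x))) (measurable_rho.mul hF)]
  refine setLIntegral_congr_fun measurableSet_Ioo ?_
  intro y hy
  simp only
  unfold UE
  rw [← ENNReal.tsum_mul_right, ← ENNReal.tsum_mul_left]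
  congr 1
  funext k
  rw [gaussMap_br k hy]
  have key : ENNReal.ofReal (br k y ^ 2) * rho (br k y) = rho y * ENNReal.ofReal (pk k y) := by
    unfold rho
    have : 0 < Real.log 2 := Real.log_pos (by norm_num)
    have := hy.1
    rw [← ENNReal.ofReal_mul (by positivity), ← ENNReal.ofReal_mul (by positivity)]
    congr 1
    unfold br pk
    have h1 : (k : ℝ) + 1 + y ≠ 0 := by positivity
    have h2 : (k : ℝ) + 2 + y ≠ 0 := by positivity
    have h3 : 1 + ((k : ℝ) + 1 + y)⁻¹ = (k + 2 + y) / (k + 1 + y) := by field_simp; ring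
    rw [h3]
    field_simp
  calc _ = (ENNReal.ofReal (br k y ^ 2) * rho (br k y)) * (g (br k y) * h y) := by ring
    _ = _ := by rw [key]; ring

lemma UE_one {y : ℝ} (hy : 0 ≤ y) : UE (fun _ => 1) y = 1 := by
  unfold UE
  simp only [mul_one]
  rw [← ENNReal.ofReal_tsum_of_nonneg (fun k => pk_nonneg k hy) (pk_hasSum hy).summable,
    (pk_hasSum hy).tsum_eq, ENNReal.ofReal_one]

lemma ae_mem : ∀ᵐ x ∂gm, x ∈ Set.Ioo (0 : ℝ) 1 :=
  (ae_gm_iff _).2 (ae_restrict_mem measurableSet_Ioo)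

lemma gm_inv (h : ℝ → ENNReal) (hh : Measurable h) :
    ∫⁻ x, h (gaussMap x) ∂gm = ∫⁻ x, h x ∂gm := by
  have := transfer (fun _ => 1) h measurable_const hh
  simp only [one_mul] at this
  rw [this]
  refine lintegral_congr_ae ?_
  filter_upwards [ae_mem] with x hx
  rw [UE_one hx.1.le, one_mul]

lemma mp : MeasurePreserving gaussMap gm gm := by
  refine ⟨measurable_gaussMap, ?_⟩
  ext s hs
  rw [Measure.map_apply measurable_gaussMap hs]
  have := gm_inv (s.indicator 1) (measurable_one.indicator hs)
  rw [lintegral_indicator_one hs] at this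
  rw [← this, ← lintegral_indicator_one (measurable_gaussMap hs)]
  rfl

lemma transfer_iter (m : ℕ) : ∀ (g h : ℝ → ENNReal) (_ : Measurable g) (_ : Measurable h),
    ∫⁻ x, g x * h (gaussMap^[m] x) ∂gm = ∫⁻ x, UE^[m] g x * h x ∂gm := by
  induction m with
  | zero => intro g h _ _; rfl
  | succ m ih =>
    intro g h hg hh
    simp only [Function.iterate_succ_apply]
    rw [← ih _ _ (UE_measurable hg) hh]
    exact transfer g (fun x => h (gaussMap^[m] x)) hg
      (hh.comp (measurable_gaussMap.iterate m))

instance : IsProbabilityMeasure gm := by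
  constructor
  have h := lintegral_gm (fun _ => 1) measurable_const
  simp only [lintegral_one, mul_one] at h
  rw [h]
  have hl : 0 < Real.log 2 := Real.log_pos (by norm_num)
  unfold rho
  have hc : ContinuousOn (fun x : ℝ => (Real.log 2)⁻¹ * (1 + x)⁻¹) (Set.Icc 0 1) := by
    refine continuousOn_const.mul (ContinuousOn.inv₀ (by fun_prop) ?_)
    intro x hx
    have := hx.1
    positivity
  have hi : IntegrableOn (fun x : ℝ => (Real.log 2)⁻¹ * (1 + x)⁻¹) (Set.Ioo 0 1) :=
    (hc.integrableOn_Icc).mono_set Set.Ioo_subset_Icc_self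
  rw [← ofReal_integral_eq_lintegral_ofReal hi]
  · rw [← integral_Ioc_eq_integral_Ioo, ← intervalIntegral.integral_of_le (by norm_num)]
    rw [intervalIntegral.integral_const_mul]
    have := intervalIntegral.integral_comp_add_left (fun x : ℝ => x⁻¹) (a := 0) (b := 1) 1
    rw [this, integral_inv_of_pos (by norm_num) (by norm_num)]
    norm_num
  · refine (ae_restrict_iff' measurableSet_Ioo).2 (Eventually.of_forall fun x hx => ?_)
    have := hx.1
    simp only [Pi.zero_apply]
    positivity

lemma measurable_lf : Measurable lf := by
  unfold lf; exact Real.measurable_log.neg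

lemma gm_le : gm ≤ ENNReal.ofReal (Real.log 2)⁻¹ • volume.restrict (Set.Ioo (0 : ℝ) 1) := by
  unfold gm
  rw [← withDensity_const]
  refine withDensity_mono ?_
  refine (ae_restrict_iff' measurableSet_Ioo).2 (Eventually.of_forall fun x hx => ?_)
  unfold rho
  apply ENNReal.ofReal_le_ofReal
  have hl : 0 < Real.log 2 := Real.log_pos (by norm_num)
  apply mul_le_of_le_one_right (by positivity)
  apply inv_le_one_of_one_le₀
  linarith [hx.1]

lemma integrable_gm {F : ℝ → ℝ} (hF : IntegrableOn F (Set.Ioo 0 1)) : Integrable F gm :=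
  (Integrable.smul_measure hF ENNReal.ofReal_ne_top).mono_measure gm_le

lemma integrable_lf_sq : Integrable (fun x => lf x ^ 2) gm := by
  apply integrable_gm
  have h : IntegrableOn (fun x : ℝ => 16 * x ^ (-(1 / 2) : ℝ)) (Set.Ioo 0 1) := by
    apply Integrable.const_mul
    exact (intervalIntegral.integrableOn_Ioo_rpow_iff (by norm_num)).2 (by norm_num)
  refine Integrable.mono' h (measurable_lf.pow_const 2).aestronglyMeasurable ?_
  refine (ae_restrict_iff' measurableSet_Ioo).2 (Eventually.of_forall fun x hx => ?_)
  rw [Real.norm_eq_abs, abs_of_nonneg (sq_nonneg _)]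
  have h0 := lf_nonneg ⟨hx.1, hx.2.le⟩
  have h1 := lf_le hx.1 (e := 1 / 4) (by norm_num)
  have h2 : (x⁻¹ ^ (1 / 4 : ℝ)) ^ 2 = x ^ (-(1 / 2) : ℝ) := by
    rw [← Real.rpow_natCast, ← Real.rpow_mul (inv_nonneg.2 hx.1.le), Real.inv_rpow hx.1.le,
      ← Real.rpow_neg hx.1.le]
    norm_num
  calc lf x ^ 2 ≤ (x⁻¹ ^ (1 / 4 : ℝ) / (1 / 4)) ^ 2 := by gcongr
    _ = 16 * (x⁻¹ ^ (1 / 4 : ℝ)) ^ 2 := by ring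
    _ = _ := by rw [h2]

lemma memLp_lf : MemLp lf 2 gm :=
  (memLp_two_iff_integrable_sq measurable_lf.aestronglyMeasurable).2 integrable_lf_sq

/-- the mean -/
noncomputable def cm : ℝ := ∫ x, lf x ∂gm

lemma lf_ae_nonneg : 0 ≤ᵐ[gm] lf := by
  filter_upwards [ae_mem] with x hx
  exact lf_nonneg ⟨hx.1, hx.2.le⟩

lemma integrable_lf : Integrable lf gm := memLp_lf.integrable (by norm_num)

lemma cm_nonneg : 0 ≤ cm := integral_nonneg_of_ae lf_ae_nonneg

lemma lintegral_lf : ∫⁻ x, ENNReal.ofReal (lf x) ∂gm = ENNReal.ofReal cm :=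
  (ofReal_integral_eq_lintegral_ofReal integrable_lf lf_ae_nonneg).symm

/-- first oscillation -/
noncomputable def vo : ℝ := U lf 1 - U lf 0

lemma vo_nonneg : 0 ≤ vo := by
  unfold vo
  have := U_le_of_antitone lf_gr lf_anti (x := 0) (y := 1) (by simp) (by simp) (by norm_num)
  linarith

lemma U_iter_le (m : ℕ) {x : ℝ} (hx : x ∈ Set.Ioo (0 : ℝ) 1) :
    U^[m + 1] lf x ≤ cm + vo / 2 ^ m := by
  have hm : Measurable fun x => ENNReal.ofReal (lf x) := measurable_lf.ennreal_ofReal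
  have h1 : ∫⁻ x, UE^[m + 1] (fun x => ENNReal.ofReal (lf x)) x ∂gm = ENNReal.ofReal cm := by
    have := transfer_iter (m + 1) (fun x => ENNReal.ofReal (lf x)) (fun _ => 1) hm measurable_const
    simp only [mul_one] at this
    rw [← this, lintegral_lf]
  have h2 : ENNReal.ofReal (U^[m + 1] lf x - vo / 2 ^ m) ≤ ENNReal.ofReal cm := by
    rw [← h1]
    have : ENNReal.ofReal (U^[m + 1] lf x - vo / 2 ^ m) =
        ∫⁻ _, ENNReal.ofReal (U^[m + 1] lf x - vo / 2 ^ m) ∂gm := by simp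
    rw [this]
    refine lintegral_mono_ae ?_
    filter_upwards [ae_mem] with y hy
    rw [UE_iter_eq (m + 1) y ⟨hy.1, hy.2.le⟩]
    apply ENNReal.ofReal_le_ofReal
    have := (U_iter_osc m).le (x := x) (y := y) ⟨hx.1.le, hx.2.le⟩ ⟨hy.1.le, hy.2.le⟩
    unfold vo
    linarith
  have := (ENNReal.ofReal_le_ofReal_iff cm_nonneg).1 h2
  linarith

lemma memLp_iter (i : ℕ) : MemLp (fun x => lf (gaussMap^[i] x)) 2 gm :=
  memLp_lf.comp_measurePreserving (mp.iterate i)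

lemma cov_bound (m : ℕ) :
    ∫ x, lf x * lf (gaussMap^[m + 1] x) ∂gm ≤ cm ^ 2 + vo * cm / 2 ^ m := by
  have hm : Measurable fun x => ENNReal.ofReal (lf x) := measurable_lf.ennreal_ofReal
  have hnn := (mp.iterate (m + 1)).quasiMeasurePreserving.ae lf_ae_nonneg
  have hK : 0 ≤ cm + vo / 2 ^ m :=
    add_nonneg cm_nonneg (div_nonneg vo_nonneg (by positivity))
  rw [integral_eq_lintegral_of_nonneg_ae]
  · refine ENNReal.toReal_le_of_le_ofReal ?_ ?_
    · have h1 := cm_nonneg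
      have h2 := vo_nonneg
      positivity
    calc ∫⁻ x, ENNReal.ofReal (lf x * lf (gaussMap^[m + 1] x)) ∂gm
        = ∫⁻ x, ENNReal.ofReal (lf x) * ENNReal.ofReal (lf (gaussMap^[m + 1] x)) ∂gm := by
          refine lintegral_congr_ae ?_
          filter_upwards [lf_ae_nonneg] with x hx
          rw [ENNReal.ofReal_mul hx]
      _ = ∫⁻ x, UE^[m + 1] (fun x => ENNReal.ofReal (lf x)) x * ENNReal.ofReal (lf x) ∂gm :=
          transfer_iter (m + 1) _ (fun x => ENNReal.ofReal (lf x)) hm hm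
      _ ≤ ∫⁻ x, ENNReal.ofReal (cm + vo / 2 ^ m) * ENNReal.ofReal (lf x) ∂gm := by
          refine lintegral_mono_ae ?_
          filter_upwards [ae_mem] with x hx
          rw [UE_iter_eq (m + 1) x ⟨hx.1, hx.2.le⟩]
          gcongr
          exact U_iter_le m hx
      _ = ENNReal.ofReal (cm + vo / 2 ^ m) * ENNReal.ofReal cm := by
          rw [lintegral_const_mul _ hm, lintegral_lf]
      _ = _ := by
          rw [← ENNReal.ofReal_mul hK]
          congr 1
          ring
  · filter_upwards [lf_ae_nonneg, hnn] with x h1 h2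
    exact mul_nonneg h1 h2
  · exact (measurable_lf.mul (measurable_lf.comp
      (measurable_gaussMap.iterate (m + 1)))).aestronglyMeasurable

lemma integral_iter (i : ℕ) (F : ℝ → ℝ) (hF : Measurable F) :
    ∫ x, F (gaussMap^[i] x) ∂gm = ∫ x, F x ∂gm := by
  have h := (mp.iterate i).map_eq
  have h2 := integral_map (mp.iterate i).aemeasurable (f := F) (μ := gm)
    hF.aestronglyMeasurable
  rw [h] at h2
  exact h2.symm

lemma cov_bound' (i m : ℕ) :
    ∫ x, lf (gaussMap^[i] x) * lf (gaussMap^[i + (m + 1)] x) ∂gm ≤ cm ^ 2 + vo * cm / 2 ^ m := by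
  have h := integral_iter i (fun x => lf x * lf (gaussMap^[m + 1] x))
    (measurable_lf.mul (measurable_lf.comp (measurable_gaussMap.iterate (m + 1))))
  simp only [← Function.iterate_add_apply] at h
  rw [add_comm i (m + 1), h]
  exact cov_bound m

/-- Birkhoff sums -/
noncomputable def Sn (n : ℕ) (x : ℝ) : ℝ := ∑ i ∈ Finset.range n, lf (gaussMap^[i] x)

lemma memLp_Sn (n : ℕ) : MemLp (Sn n) 2 gm := by
  have := memLp_finsetSum (Finset.range n) (fun i _ => memLp_iter i)
  exact this

lemma integral_Sn (n : ℕ) : ∫ x, Sn n x ∂gm = n * cm := by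
  unfold Sn
  rw [integral_finsetSum _ (fun i _ => (memLp_iter i).integrable (by norm_num))]
  have : ∀ i ∈ Finset.range n, ∫ x, lf (gaussMap^[i] x) ∂gm = cm := fun i _ =>
    integral_iter i lf measurable_lf
  rw [Finset.sum_congr rfl this]
  simp

lemma cross_bound (n : ℕ) :
    ∫ x, Sn n x * lf (gaussMap^[n] x) ∂gm ≤ n * cm ^ 2 + 2 * (vo * cm) := by
  have hvc : 0 ≤ vo * cm := mul_nonneg vo_nonneg cm_nonneg
  unfold Sn
  simp only [Finset.sum_mul]
  have hInt : ∀ i ∈ Finset.range n,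
      Integrable (fun x => lf (gaussMap^[i] x) * lf (gaussMap^[n] x)) gm :=
    fun i _ => (memLp_iter i).integrable_mul (memLp_iter n)
  rw [integral_finsetSum _ hInt]
  calc _ ≤ ∑ i ∈ Finset.range n, (cm ^ 2 + vo * cm * (1 / 2 : ℝ) ^ (n - 1 - i)) := by
        refine Finset.sum_le_sum fun i hi => ?_
        have hi' := Finset.mem_range.1 hi
        have := cov_bound' i (n - 1 - i)
        rw [show i + (n - 1 - i + 1) = n by omega] at this
        refine this.trans_eq ?_
        rw [one_div, inv_pow, div_eq_mul_inv]
    _ = n * cm ^ 2 + vo * cm * ∑ i ∈ Finset.range n, (1 / 2 : ℝ) ^ (n - 1 - i) := by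
        rw [Finset.sum_add_distrib, Finset.mul_sum]
        simp
    _ = n * cm ^ 2 + vo * cm * ∑ i ∈ Finset.range n, (1 / 2 : ℝ) ^ i := by
        rw [Finset.sum_range_reflect (fun i => (1 / 2 : ℝ) ^ i) n]
    _ ≤ n * cm ^ 2 + vo * cm * 2 := by
        gcongr
        exact sum_geometric_two_le n
    _ = _ := by ring

/-- variance constant -/
noncomputable def Dv : ℝ := 4 * (vo * cm) + ∫ x, lf x ^ 2 ∂gm

lemma Dv_nonneg : 0 ≤ Dv := by
  have hvc : 0 ≤ vo * cm := mul_nonneg vo_nonneg cm_nonneg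
  have : 0 ≤ ∫ x, lf x ^ 2 ∂gm := integral_nonneg fun x => sq_nonneg _
  unfold Dv
  linarith

lemma second_moment (n : ℕ) : ∫ x, Sn n x ^ 2 ∂gm ≤ n ^ 2 * cm ^ 2 + n * Dv := by
  induction n with
  | zero => simp [Sn]
  | succ n ih =>
    have he : ∀ x, Sn (n + 1) x ^ 2 =
        Sn n x ^ 2 + 2 * (Sn n x * lf (gaussMap^[n] x)) + lf (gaussMap^[n] x) ^ 2 := by
      intro x
      unfold Sn
      rw [Finset.sum_range_succ]
      ring
    have i1 := (memLp_Sn n).integrable_sq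
    have i2 : Integrable (fun x => 2 * (Sn n x * lf (gaussMap^[n] x))) gm :=
      ((memLp_Sn n).integrable_mul (memLp_iter n)).const_mul 2
    have i3 := (memLp_iter n).integrable_sq
    simp_rw [he]
    have i4 : Integrable (fun x => Sn n x ^ 2 + 2 * (Sn n x * lf (gaussMap^[n] x))) gm := i1.add i2
    rw [integral_add i4 i3, integral_add i1 i2, integral_const_mul]
    have h3 : ∫ x, lf (gaussMap^[n] x) ^ 2 ∂gm = ∫ x, lf x ^ 2 ∂gm :=
      integral_iter n (fun x => lf x ^ 2) (measurable_lf.pow_const 2)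
    rw [h3]
    have hc := cross_bound n
    push_cast
    unfold Dv at *
    nlinarith [sq_nonneg cm]

lemma variance_bound (n : ℕ) : ∫ x, (Sn n x - n * cm) ^ 2 ∂gm ≤ n * Dv := by
  have he : ∀ x, (Sn n x - n * cm) ^ 2 =
      Sn n x ^ 2 - 2 * (n * cm) * Sn n x + (n * cm) ^ 2 := fun x => by ring
  simp_rw [he]
  have i1 := (memLp_Sn n).integrable_sq
  have i2 : Integrable (fun x => 2 * (n * cm) * Sn n x) gm :=
    ((memLp_Sn n).integrable (by norm_num)).const_mul _
  have i4 : Integrable (fun x => Sn n x ^ 2 - 2 * (n * cm) * Sn n x) gm := i1.sub i2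
  rw [integral_add i4 (integrable_const _), integral_sub i1 i2, integral_const_mul,
    integral_Sn]
  simp only [integral_const, probReal_univ, smul_eq_mul]
  have := second_moment n
  nlinarith

lemma subseq : ∀ᵐ x ∂gm, Tendsto (fun N : ℕ => Sn ((N + 1) ^ 2) x / (((N + 1) ^ 2 : ℕ) : ℝ)) atTop
    (𝓝 cm) := by
  have hmeas : ∀ n, Measurable (Sn n) := fun n => by
    unfold Sn
    exact Finset.measurable_sum _ fun i _ => measurable_lf.comp (measurable_gaussMap.iterate i)
  have hb : ∀ N : ℕ, ∫⁻ x, ENNReal.ofReal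
      ((Sn ((N + 1) ^ 2) x / (((N + 1) ^ 2 : ℕ) : ℝ) - cm) ^ 2) ∂gm ≤
      ENNReal.ofReal (Dv * (1 / (((N + 1 : ℕ)) : ℝ) ^ 2)) := by
    intro N
    set n := (N + 1) ^ 2 with hn
    have hn0 : (0 : ℝ) < n := by rw [hn]; positivity
    have he : ∀ x, (Sn n x / (n : ℝ) - cm) ^ 2 = (1 / (n : ℝ) ^ 2) * (Sn n x - n * cm) ^ 2 := by
      intro x
      field_simp
    simp_rw [he]
    have hi : Integrable (fun x => (1 / (n : ℝ) ^ 2) * (Sn n x - n * cm) ^ 2) gm :=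
      (((memLp_Sn n).sub (memLp_const _)).integrable_sq).const_mul _
    rw [← ofReal_integral_eq_lintegral_ofReal hi
      (Eventually.of_forall fun x => by simp only [Pi.zero_apply]; positivity)]
    apply ENNReal.ofReal_le_ofReal
    rw [integral_const_mul]
    calc _ ≤ (1 / (n : ℝ) ^ 2) * (n * Dv) := by
          gcongr
          exact variance_bound n
      _ = Dv * (1 / n) := by field_simp
      _ = _ := by rw [hn]; push_cast; rfl
  have hsumm : Summable (fun N : ℕ => Dv * (1 / (((N + 1 : ℕ)) : ℝ) ^ 2)) := by
    apply Summable.mul_left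
    exact (summable_nat_add_iff 1).2 (Real.summable_one_div_nat_pow.2 (by norm_num))
  have hfin : ∫⁻ x, ∑' N : ℕ, ENNReal.ofReal
      ((Sn ((N + 1) ^ 2) x / (((N + 1) ^ 2 : ℕ) : ℝ) - cm) ^ 2) ∂gm ≠ ⊤ := by
    rw [lintegral_tsum]
    · refine ne_top_of_le_ne_top ?_ (ENNReal.tsum_le_tsum hb)
      rw [← ENNReal.ofReal_tsum_of_nonneg _ hsumm]
      · exact ENNReal.ofReal_ne_top
      · intro N
        have := Dv_nonneg
        positivity
    · intro N
      exact ((((hmeas _).div_const _).sub_const _).pow_const 2).ennreal_ofReal.aemeasurable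
  have hae := ae_lt_top (Measurable.tsum fun N => 
      ((((hmeas ((N + 1) ^ 2)).div_const _).sub_const _).pow_const 2).ennreal_ofReal) hfin
  filter_upwards [hae] with x hx
  have h0 := ENNReal.tendsto_atTop_zero_of_tsum_ne_top hx.ne
  have h1 := (ENNReal.tendsto_toReal ENNReal.zero_ne_top).comp h0
  simp only [Function.comp_def, ENNReal.toReal_ofReal (sq_nonneg _), ENNReal.toReal_zero] at h1
  have h2 := (Real.continuous_sqrt.tendsto 0).comp h1
  simp only [Function.comp_def, Real.sqrt_sq_eq_abs, Real.sqrt_zero] at h2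
  have h3 := tendsto_zero_iff_abs_tendsto_zero _ |>.2 h2
  simpa using h3.add_const cm

lemma ae_orbit : ∀ᵐ x ∂gm, ∀ i, gaussMap^[i] x ∈ Set.Ioo (0 : ℝ) 1 := by
  rw [ae_all_iff]
  intro i
  exact (mp.iterate i).quasiMeasurePreserving.ae ae_mem

lemma birkhoff : ∀ᵐ x ∂gm, Tendsto (fun n : ℕ => Sn n x / n) atTop (𝓝 cm) := by
  filter_upwards [subseq, ae_orbit] with x hx ho
  refine tendsto_div_of_monotone_of_exists_subseq_tendsto_div (fun n => Sn n x) cm ?_ ?_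
  · refine monotone_nat_of_le_succ fun n => ?_
    unfold Sn
    rw [Finset.sum_range_succ]
    have := lf_nonneg ⟨(ho n).1, (ho n).2.le⟩
    linarith
  · intro a ha
    refine ⟨fun N => (N + 1) ^ 2, ?_, ?_, hx⟩
    · have h1 : Tendsto (fun n : ℕ => (1 + 1 / ((n : ℝ) + 1)) ^ 2) atTop (𝓝 ((1 + 0) ^ 2)) :=
        (tendsto_one_div_add_atTop_nhds_zero_nat.const_add 1).pow 2
      have h2 := h1.eventually_le_const (show ((1 : ℝ) + 0) ^ 2 < a by simpa using ha)
      filter_upwards [h2] with n hn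
      push_cast
      have : ((n : ℝ) + 1 + 1) ^ 2 = (1 + 1 / ((n : ℝ) + 1)) ^ 2 * ((n : ℝ) + 1) ^ 2 := by
        field_simp
      rw [this]
      gcongr
    · refine tendsto_atTop_mono (fun n => ?_) tendsto_id
      simp only [id]
      nlinarith

lemma alt_sum : HasSum (fun k : ℕ => (-1 : ℝ) ^ k * (1 / ((k : ℝ) + 1) ^ 2)) (π ^ 2 / 12) := by
  have h0 : HasSum (fun k : ℕ => 1 / ((k : ℝ) + 1) ^ 2) (π ^ 2 / 6) := by
    have := (hasSum_nat_add_iff' 1).2 hasSum_zeta_two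
    simpa using this
  have ho : HasSum (fun j : ℕ => 1 / (((2 * j + 1 : ℕ) : ℝ) + 1) ^ 2) (π ^ 2 / 24) := by
    have := h0.mul_left (1 / 4)
    convert! this using 1
    · funext j
      push_cast
      rw [show (2 * (j : ℝ) + 1 + 1) = 2 * (j + 1) by ring]
      field_simp
      norm_num
    · ring
  have hs : Summable (fun j : ℕ => 1 / (((2 * j : ℕ) : ℝ) + 1) ^ 2) :=
    h0.summable.comp_injective (i := fun j : ℕ => 2 * j)
      (fun a b h => by simpa using h)
  obtain ⟨E, hE⟩ := hs
  have h1 := HasSum.even_add_odd (f := fun k : ℕ => 1 / ((k : ℝ) + 1) ^ 2) hE ho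
  have hEv := h1.unique h0
  have h2 := HasSum.even_add_odd (f := fun k : ℕ => (-1 : ℝ) ^ k * (1 / ((k : ℝ) + 1) ^ 2))
    (m := E) (m' := -(π ^ 2 / 24)) (by simpa [pow_mul] using hE)
    (by simpa [pow_succ, pow_mul] using ho.neg)
  convert! h2 using 1
  linarith

lemma pow_lf (k : ℕ) : IntegrableOn (fun x => x ^ k * lf x) (Set.Ioo 0 1) ∧
    ∫ x in Set.Ioo (0 : ℝ) 1, x ^ k * lf x = 1 / ((k : ℝ) + 1) ^ 2 := by
  set G : ℝ → ℝ := fun x => x ^ (k + 1) / ((k : ℝ) + 1) ^ 2 - x ^ k * (x * Real.log x) / (k + 1)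
    with hG
  have hcont : Continuous G := by
    have := Real.continuous_mul_log
    fun_prop
  have hder : ∀ x ∈ Set.Ioo (0 : ℝ) 1, HasDerivAt G (x ^ k * lf x) x := by
    intro x hx
    have e : G = fun x => x ^ (k + 1) / ((k : ℝ) + 1) ^ 2 - x ^ (k + 1) * Real.log x / (k + 1) := by
      funext x; rw [hG]; ring
    rw [e]
    have h1 : HasDerivAt (fun x : ℝ => x ^ (k + 1)) (((k : ℝ) + 1) * x ^ k) x := by
      simpa using hasDerivAt_pow (k + 1) x
    have h2 := ((h1.div_const (((k : ℝ) + 1) ^ 2)).sub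
      ((h1.mul (Real.hasDerivAt_log hx.1.ne')).div_const ((k : ℝ) + 1)))
    refine HasDerivAt.congr_deriv h2 ?_
    unfold lf
    have hx0 : x ≠ 0 := hx.1.ne'
    field_simp
    ring
  have hi : IntegrableOn (fun x => x ^ k * lf x) (Set.Ioc 0 1) := by
    refine intervalIntegral.integrableOn_deriv_of_nonneg hcont.continuousOn hder ?_
    intro x hx
    exact mul_nonneg (pow_nonneg hx.1.le _) (lf_nonneg ⟨hx.1, hx.2.le⟩)
  refine ⟨hi.mono_set Set.Ioo_subset_Ioc_self, ?_⟩
  rw [← integral_Ioc_eq_integral_Ioo, ← intervalIntegral.integral_of_le (by norm_num),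
    intervalIntegral.integral_eq_sub_of_hasDerivAt_of_le (by norm_num) hcont.continuousOn hder
      ((intervalIntegrable_iff_integrableOn_Ioc_of_le (by norm_num)).2 hi)]
  simp [hG]

lemma integral_series : ∫ x in Set.Ioo (0 : ℝ) 1, (1 + x)⁻¹ * lf x = π ^ 2 / 12 := by
  have hi : ∀ k : ℕ, Integrable (fun x => (-1 : ℝ) ^ k * (x ^ k * lf x))
      (volume.restrict (Set.Ioo (0 : ℝ) 1)) := fun k => (pow_lf k).1.const_mul _
  have hn : ∀ k : ℕ, ∫ x in Set.Ioo (0 : ℝ) 1, ‖(-1 : ℝ) ^ k * (x ^ k * lf x)‖ =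
      1 / ((k : ℝ) + 1) ^ 2 := by
    intro k
    rw [← (pow_lf k).2]
    refine setIntegral_congr_fun measurableSet_Ioo fun x hx => ?_
    simp only [norm_mul, norm_pow, norm_neg, norm_one, one_pow, one_mul]
    rw [Real.norm_of_nonneg hx.1.le, Real.norm_of_nonneg (lf_nonneg ⟨hx.1, hx.2.le⟩)]
  have hs : Summable fun k : ℕ => ∫ x in Set.Ioo (0 : ℝ) 1, ‖(-1 : ℝ) ^ k * (x ^ k * lf x)‖ := by
    simp_rw [hn]
    have := (summable_nat_add_iff 1).2 (Real.summable_one_div_nat_pow.2 (one_lt_two))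
    simpa using this
  have h := hasSum_integral_of_summable_integral_norm hi hs
  simp_rw [integral_const_mul, (pow_lf _).2] at h
  rw [alt_sum.unique h]
  refine setIntegral_congr_fun measurableSet_Ioo fun x hx => ?_
  have hg := (hasSum_geometric_of_abs_lt_one (r := -x)
    (by rw [abs_neg, abs_of_pos hx.1]; exact hx.2)).mul_right (lf x)
  rw [sub_neg_eq_add] at hg
  rw [← hg.tsum_eq]
  congr 1
  funext k
  rw [neg_pow]
  ring

lemma cm_eq : cm = π ^ 2 / (12 * Real.log 2) := by
  have hl : 0 < Real.log 2 := Real.log_pos (by norm_num)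
  unfold cm gm
  rw [integral_withDensity_eq_integral_toReal_smul measurable_rho
    (Eventually.of_forall fun x => by unfold rho; exact ENNReal.ofReal_lt_top)]
  have : ∫ x in Set.Ioo (0 : ℝ) 1, (rho x).toReal • lf x =
      ∫ x in Set.Ioo (0 : ℝ) 1, (Real.log 2)⁻¹ * ((1 + x)⁻¹ * lf x) := by
    refine setIntegral_congr_fun measurableSet_Ioo fun x hx => ?_
    have := hx.1
    simp only [smul_eq_mul]
    unfold rho
    rw [ENNReal.toReal_ofReal (by positivity)]
    ring
  rw [this, integral_const_mul, integral_series]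
  field_simp

lemma inv_orbit {x : ℝ} (ho : ∀ i, gaussMap^[i] x ∈ Set.Ioo (0 : ℝ) 1)
    (n : ℕ) : (gaussMap^[n] x)⁻¹ = (partQuot x (n + 1) : ℝ) + gaussMap^[n + 1] x := by
  have h := ho n
  have hinv : 1 < (gaussMap^[n] x)⁻¹ := (one_lt_inv₀ h.1).2 h.2
  have hfl : 0 ≤ ⌊(gaussMap^[n] x)⁻¹⌋ := Int.floor_nonneg.2 (by linarith)
  rw [Function.iterate_succ_apply']
  have : ((⌊(gaussMap^[n] x)⁻¹⌋.toNat : ℕ) : ℝ) = (⌊(gaussMap^[n] x)⁻¹⌋ : ℝ) := by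
    exact_mod_cast Int.toNat_of_nonneg hfl
  change _ = ((⌊(gaussMap^[n] x)⁻¹⌋.toNat : ℕ) : ℝ) + Int.fract (gaussMap^[n] x)⁻¹
  rw [this, Int.floor_add_fract]

lemma partQuot_pos {x : ℝ} (ho : ∀ i, gaussMap^[i] x ∈ Set.Ioo (0 : ℝ) 1)
    (n : ℕ) : 1 ≤ partQuot x (n + 1) := by
  have h := inv_orbit ho n
  have h1 := ho n
  have h2 := ho (n + 1)
  have hinv : 1 < (gaussMap^[n] x)⁻¹ := (one_lt_inv₀ h1.1).2 h1.2
  by_contra hc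
  have : partQuot x (n + 1) = 0 := by omega
  rw [this] at h
  push_cast at h
  linarith [h2.2]

lemma cfQ_facts {x : ℝ} (ho : ∀ i, gaussMap^[i] x ∈ Set.Ioo (0 : ℝ) 1)
    (n : ℕ) : 1 ≤ cfQ x n ∧ cfQ x n ≤ cfQ x (n + 1) := by
  induction n with
  | zero =>
    refine ⟨by simp [cfQ], ?_⟩
    have := partQuot_pos ho 0
    simp only [cfQ]
    exact_mod_cast this
  | succ n ih =>
    have h := partQuot_pos ho (n + 1)
    have h' : (1 : ℤ) ≤ partQuot x (n + 2) := by exact_mod_cast h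
    refine ⟨by omega, ?_⟩
    rw [cfQ]
    nlinarith [ih.1, ih.2]

lemma prod_eq {x : ℝ} (ho : ∀ i, gaussMap^[i] x ∈ Set.Ioo (0 : ℝ) 1)
    (n : ℕ) : (cfQ x (n + 1) : ℝ) + cfQ x n * gaussMap^[n + 1] x =
    (∏ i ∈ Finset.range (n + 1), gaussMap^[i] x)⁻¹ := by
  induction n with
  | zero =>
    have := inv_orbit ho 0
    simp only [cfQ]
    simp at this ⊢
    exact this.symm
  | succ n ih =>
    have h := inv_orbit ho (n + 1)
    have hne : gaussMap^[n + 1] x ≠ 0 := (ho (n + 1)).1.ne'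
    rw [Finset.prod_range_succ, mul_inv, ← ih, cfQ, h.symm.symm]
    have h3 : gaussMap^[n + 1] x * ((partQuot x (n + 1 + 1) : ℝ) + gaussMap^[n + 1 + 1] x) = 1 := by
      rw [← h]; exact mul_inv_cancel₀ hne
    push_cast
    linear_combination (-(cfQ x n : ℝ)) * h3

lemma diff_eq {x : ℝ} (ho : ∀ i, gaussMap^[i] x ∈ Set.Ioo (0 : ℝ) 1)
    (n : ℕ) : (cfQ x n : ℝ) * x - cfP x n =
      (-1) ^ n * ∏ i ∈ Finset.range (n + 1), gaussMap^[i] x ∧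
    (cfQ x (n + 1) : ℝ) * x - cfP x (n + 1) =
      (-1) ^ (n + 1) * ∏ i ∈ Finset.range (n + 2), gaussMap^[i] x := by
  induction n with
  | zero =>
    have h := inv_orbit ho 0
    have hne : x ≠ 0 := (ho 0).1.ne'
    have h3 : x * ((partQuot x (0 + 1) : ℝ) + gaussMap^[0 + 1] x) = 1 := by
      rw [← h]; exact mul_inv_cancel₀ hne
    refine ⟨by simp [cfQ, cfP], ?_⟩
    simp [cfQ, cfP, Finset.prod_range_succ] at h3 ⊢
    linear_combination h3
  | succ n ih =>
    refine ⟨ih.2, ?_⟩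
    have h := inv_orbit ho (n + 1)
    have hne : gaussMap^[n + 1] x ≠ 0 := (ho (n + 1)).1.ne'
    have h3 : gaussMap^[n + 1] x * ((partQuot x (n + 2) : ℝ) + gaussMap^[n + 2] x) = 1 := by
      rw [← h]; exact mul_inv_cancel₀ hne
    obtain ⟨i1, i2⟩ := ih
    rw [Finset.prod_range_succ] at i2 ⊢
    rw [Finset.prod_range_succ]
    have e1 : (cfQ x (n + 1 + 1) : ℝ) = partQuot x (n + 2) * cfQ x (n + 1) + cfQ x n := by
      rw [cfQ]; push_cast; rfl
    have e2 : (cfP x (n + 1 + 1) : ℝ) = partQuot x (n + 2) * cfP x (n + 1) + cfP x n := by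
      rw [cfP]; push_cast; rfl
    rw [e1, e2]
    rw [pow_succ] at i2
    rw [pow_succ, pow_succ]
    linear_combination (partQuot x (n + 2) : ℝ) * i2 + i1 -
      (-1) ^ n * (∏ i ∈ Finset.range (n + 1), gaussMap^[i] x) * h3

lemma log_prod {x : ℝ} (ho : ∀ i, gaussMap^[i] x ∈ Set.Ioo (0 : ℝ) 1)
    (n : ℕ) : Real.log (∏ i ∈ Finset.range n, gaussMap^[i] x) = - Sn n x := by
  rw [Real.log_prod (fun i _ => (ho i).1.ne')]
  unfold Sn lf
  simp

lemma log_err {x : ℝ} (ho : ∀ i, gaussMap^[i] x ∈ Set.Ioo (0 : ℝ) 1)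
    (n : ℕ) : Real.log |x - (cfP x n : ℝ) / (cfQ x n : ℝ)| =
    - Sn (n + 1) x - Real.log (cfQ x n) := by
  have hq : (0 : ℝ) < cfQ x n := by
    have := (cfQ_facts ho n).1
    exact_mod_cast this
  have hp : 0 < ∏ i ∈ Finset.range (n + 1), gaussMap^[i] x :=
    Finset.prod_pos fun i _ => (ho i).1
  have h : x - (cfP x n : ℝ) / (cfQ x n : ℝ) =
      ((-1) ^ n * ∏ i ∈ Finset.range (n + 1), gaussMap^[i] x) / cfQ x n := by
    rw [← (diff_eq ho n).1]
    field_simp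
  rw [h, abs_div, abs_mul, abs_pow, abs_neg, abs_one, one_pow, one_mul, abs_of_pos hp,
    abs_of_pos hq, Real.log_div hp.ne' hq.ne', log_prod ho]

lemma log_q {x : ℝ} (ho : ∀ i, gaussMap^[i] x ∈ Set.Ioo (0 : ℝ) 1)
    (n : ℕ) : Sn n x - Real.log 2 ≤ Real.log (cfQ x n) ∧ Real.log (cfQ x n) ≤ Sn n x := by
  have hl : 0 < Real.log 2 := Real.log_pos (by norm_num)
  cases n with
  | zero =>
    simp [cfQ, Sn, hl.le]
  | succ n =>
    obtain ⟨h1, h2⟩ := cfQ_facts ho n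
    have h1' : (1 : ℝ) ≤ cfQ x n := by exact_mod_cast h1
    have h2' : (cfQ x n : ℝ) ≤ cfQ x (n + 1) := by exact_mod_cast h2
    have hS : Sn (n + 1) x = Real.log ((cfQ x (n + 1) : ℝ) + cfQ x n * gaussMap^[n + 1] x) := by
      rw [prod_eq ho, Real.log_inv, log_prod ho, neg_neg]
    have hx := ho (n + 1)
    have hpos : 0 < (cfQ x n : ℝ) * gaussMap^[n + 1] x := mul_pos (by linarith) hx.1
    rw [hS]
    constructor
    · rw [sub_le_iff_le_add, ← Real.log_mul (by linarith) (by norm_num)]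
      apply Real.log_le_log (by linarith)
      nlinarith [hx.2]
    · apply Real.log_le_log (by linarith)
      linarith

lemma det_limit {x : ℝ} (ho : ∀ i, gaussMap^[i] x ∈ Set.Ioo (0 : ℝ) 1)
    {c : ℝ} (h : Tendsto (fun n : ℕ => Sn n x / n) atTop (𝓝 c)) :
    Tendsto (fun n : ℕ => Real.log |x - (cfP x n : ℝ) / (cfQ x n : ℝ)| / n) atTop
      (𝓝 (-(c + c))) := by
  have hshift : Tendsto (fun n : ℕ => Sn (n + 1) x / n) atTop (𝓝 c) := by
    have h1 : Tendsto (fun n : ℕ => Sn (n + 1) x / ((n + 1 : ℕ) : ℝ)) atTop (𝓝 c) :=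
      h.comp (tendsto_add_atTop_nat 1)
    have h2 : Tendsto (fun n : ℕ => 1 + 1 / (n : ℝ)) atTop (𝓝 (1 + 0)) :=
      tendsto_one_div_atTop_nhds_zero_nat.const_add 1
    have h3 := h1.mul h2
    rw [add_zero, mul_one] at h3
    refine h3.congr' ?_
    filter_upwards [eventually_gt_atTop 0] with n hn
    have : (0 : ℝ) < n := by exact_mod_cast hn
    push_cast
    field_simp
  have hlq : Tendsto (fun n : ℕ => Real.log (cfQ x n) / n) atTop (𝓝 c) := by
    have h0 : Tendsto (fun n : ℕ => Sn n x / n - Real.log 2 / n) atTop (𝓝 (c - 0)) :=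
      h.sub (tendsto_const_div_atTop_nhds_zero_nat _)
    rw [sub_zero] at h0
    refine tendsto_of_tendsto_of_tendsto_of_le_of_le h0 h ?_ ?_
    · intro n
      simp only
      rw [← sub_div]
      exact div_le_div_of_nonneg_right (log_q ho n).1 (Nat.cast_nonneg n)
    · intro n
      exact div_le_div_of_nonneg_right (log_q ho n).2 (Nat.cast_nonneg n)
  refine (hshift.add hlq).neg.congr fun n => ?_
  rw [log_err ho]
  ring

end Levy

/-- For almost every `x ∈ (0,1)`, `(1/n)·log |x − pₙ/qₙ| → −π²/(6 log 2)`. -/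
theorem levy_log_error :
    ∀ᵐ x ∂(volume.restrict (Set.Ioo (0 : ℝ) 1)),
      Tendsto (fun n : ℕ => Real.log |x - (cfP x n : ℝ) / (cfQ x n : ℝ)| / n) atTop
        (𝓝 (-(π ^ 2 / (6 * Real.log 2)))) := by
  rw [← Levy.ae_gm_iff]
  filter_upwards [Levy.birkhoff, Levy.ae_orbit] with x h ho
  have := Levy.det_limit ho h
  have e : Levy.cm + Levy.cm = π ^ 2 / (6 * Real.log 2) := by
    have hl : 0 < Real.log 2 := Real.log_pos (by norm_num)
    rw [Levy.cm_eq]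
    field_simp
    norm_num
  rwa [e] at this
end
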